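/- arXiv:1108.0030 — 9 statements merged into one kernel-verified Lean document; each statement's English description precedes it below -/
import Mathlib

section
/- Let H be a bialgebra over ℂ. The linear map ν : H⊗H → H⊗H determined by ν(h⊗h') = h⁽¹⁾ ⊗ h⁽²⁾·h' is bijective if and only if H is a Hopf algebra, i.e. there exists a linear map S : H → H satisfying S(h⁽¹⁾)h⁽²⁾ = ε(h)1 and h⁽¹⁾S(h⁽²⁾) = ε(h)1 for all h ∈ H. Moreover, in that case the inverse of ν is given by ν⁻¹(h⊗h') = h⁽¹⁾ ⊗ S(h⁽²⁾)·h'. -/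
/-!
STATEMENT 1: For a bialgebra `H` over `ℂ`, the linear map `ν : H ⊗ H → H ⊗ H`
determined by `ν (h ⊗ h') = h⁽¹⁾ ⊗ h⁽²⁾ * h'` is bijective iff `H` admits a
(two-sided) antipode, and in that case its inverse is
`νinv S (h ⊗ h') = h⁽¹⁾ ⊗ S (h⁽²⁾) * h'`.
-/

open TensorProduct

noncomputable section

namespace Stmt1

variable (H : Type*) [Ring H] [Bialgebra ℂ H]

/-- `ν (h ⊗ h') = h⁽¹⁾ ⊗ h⁽²⁾ * h'`. -/
def ν : H ⊗[ℂ] H →ₗ[ℂ] H ⊗[ℂ] H :=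
  TensorProduct.map LinearMap.id (LinearMap.mul' ℂ H)
    ∘ₗ (TensorProduct.assoc ℂ H H H).toLinearMap
    ∘ₗ LinearMap.rTensor H (Coalgebra.comul (R := ℂ))

variable {H}

/-- `S` is a (two-sided) antipode for `H`, i.e. `S (h⁽¹⁾) * h⁽²⁾ = ε(h) 1` and
`h⁽¹⁾ * S (h⁽²⁾) = ε(h) 1` for all `h`. -/
def IsAntipode (S : H →ₗ[ℂ] H) : Prop :=
  (∀ h : H, LinearMap.mul' ℂ H (TensorProduct.map S LinearMap.id (Coalgebra.comul (R := ℂ) h)) =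
      (Coalgebra.counit (R := ℂ) h) • (1 : H)) ∧
  (∀ h : H, LinearMap.mul' ℂ H (TensorProduct.map LinearMap.id S (Coalgebra.comul (R := ℂ) h)) =
      (Coalgebra.counit (R := ℂ) h) • (1 : H))

variable (H)

/-- `νinv S (h ⊗ h') = h⁽¹⁾ ⊗ S (h⁽²⁾) * h'`. -/
def νinv (S : H →ₗ[ℂ] H) : H ⊗[ℂ] H →ₗ[ℂ] H ⊗[ℂ] H :=
  TensorProduct.map LinearMap.id (LinearMap.mul' ℂ H)
    ∘ₗ (TensorProduct.assoc ℂ H H H).toLinearMap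
    ∘ₗ LinearMap.rTensor H (LinearMap.lTensor H S ∘ₗ Coalgebra.comul (R := ℂ))

variable {H}

/-- `D (h ⊗ h') = h⁽¹⁾ ⊗ (h⁽²⁾ ⊗ h')`. -/
def D : H ⊗[ℂ] H →ₗ[ℂ] H ⊗[ℂ] (H ⊗[ℂ] H) :=
  (TensorProduct.assoc ℂ H H H).toLinearMap ∘ₗ LinearMap.rTensor H (Coalgebra.comul (R := ℂ))

lemma D_lTensor (k : H →ₗ[ℂ] H) (x : H ⊗[ℂ] H) :
    D (LinearMap.lTensor H k x) = LinearMap.lTensor H (LinearMap.lTensor H k) (D x) := by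
  induction x with
  | zero => simp
  | add x y hx hy => simp only [map_add, hx, hy]
  | tmul a b =>
    simp only [D, LinearMap.comp_apply, LinearMap.lTensor_tmul, LinearMap.rTensor_tmul,
      LinearEquiv.coe_coe]
    induction (Coalgebra.comul (R := ℂ) a) with
    | zero => simp
    | add x y hx hy => simp only [map_add, TensorProduct.add_tmul, hx, hy]
    | tmul c d => simp

lemma D_comul (h : H) : D (Coalgebra.comul (R := ℂ) h) =
    LinearMap.lTensor H (Coalgebra.comul (R := ℂ)) (Coalgebra.comul (R := ℂ) h) :=
  Coalgebra.coassoc_apply h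

lemma νinv_eq_D (f : H →ₗ[ℂ] H) (x : H ⊗[ℂ] H) :
    νinv H f x = LinearMap.lTensor H (LinearMap.mul' ℂ H ∘ₗ LinearMap.rTensor H f) (D x) := by
  induction x with
  | zero => simp
  | add x y hx hy => simp only [map_add, hx, hy]
  | tmul a b =>
    simp only [D, νinv, LinearMap.comp_apply, LinearMap.rTensor_tmul, LinearEquiv.coe_coe]
    induction (Coalgebra.comul (R := ℂ) a) with
    | zero => simp
    | add x y hx hy => simp only [map_add, TensorProduct.add_tmul, hx, hy]
    | tmul c d => simp

lemma νinv_tmul (f : H →ₗ[ℂ] H) (a b : H) :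
    νinv H f (a ⊗ₜ b) =
      LinearMap.lTensor H (LinearMap.mulRight ℂ b ∘ₗ f) (Coalgebra.comul (R := ℂ) a) := by
  simp only [νinv, LinearMap.comp_apply, LinearMap.rTensor_tmul, LinearEquiv.coe_coe]
  induction (Coalgebra.comul (R := ℂ) a) with
  | zero => simp
  | add x y hx hy => simp only [map_add, TensorProduct.add_tmul, hx, hy]
  | tmul c d => simp

lemma ν_eq : ν H = νinv H LinearMap.id := by
  simp [ν, νinv]

/-- convolution -/
def conv (f g : H →ₗ[ℂ] H) : H →ₗ[ℂ] H :=
  LinearMap.mul' ℂ H ∘ₗ TensorProduct.map f g ∘ₗ Coalgebra.comul (R := ℂ)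

/-- convolution unit -/
def cone : H →ₗ[ℂ] H := (Coalgebra.counit (R := ℂ) (A := H)).smulRight 1

lemma νinv_comp (f g : H →ₗ[ℂ] H) : νinv H f ∘ₗ νinv H g = νinv H (conv f g) := by
  apply TensorProduct.ext'
  intro a b
  rw [LinearMap.comp_apply, νinv_tmul g, νinv_eq_D, D_lTensor, D_comul, νinv_tmul,
    ← LinearMap.comp_apply, ← LinearMap.comp_apply, ← LinearMap.lTensor_comp,
    ← LinearMap.lTensor_comp]
  congr 2
  ext x
  simp only [conv, LinearMap.comp_apply]
  induction (Coalgebra.comul (R := ℂ) x) with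
  | zero => simp
  | add x y hx hy => simp only [map_add, hx, hy]
  | tmul c d => simp [mul_assoc]

lemma νinv_cone : νinv H cone = LinearMap.id := by
  apply TensorProduct.ext'
  intro a b
  have : (LinearMap.mulRight ℂ b ∘ₗ cone : H →ₗ[ℂ] H) =
      (LinearMap.toSpanSingleton ℂ H b) ∘ₗ Coalgebra.counit (R := ℂ) := by
    ext x; simp [cone]
  rw [νinv_tmul, this, LinearMap.lTensor_comp, LinearMap.comp_apply,
    Coalgebra.lTensor_counit_comul]
  simp

/-- `ε ⊗ id`. -/
def epsL : H ⊗[ℂ] H →ₗ[ℂ] H :=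
  (TensorProduct.lid ℂ H).toLinearMap ∘ₗ LinearMap.rTensor H (Coalgebra.counit (R := ℂ))

lemma epsL_νinv (f : H →ₗ[ℂ] H) (h : H) : epsL (νinv H f (h ⊗ₜ 1)) = f h := by
  have : ∀ x : H ⊗[ℂ] H, epsL (LinearMap.lTensor H f x) = f (epsL x) := by
    intro x
    induction x with
    | zero => simp
    | add x y hx hy => simp only [map_add, hx, hy]
    | tmul c d => simp [epsL]
  rw [νinv_tmul, LinearMap.mulRight_one, LinearMap.id_comp, this]
  simp [epsL]

lemma νinv_injective {f g : H →ₗ[ℂ] H} (h : νinv H f = νinv H g) : f = g := by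
  ext x
  rw [← epsL_νinv f, h, epsL_νinv]

lemma isAntipode_iff (S : H →ₗ[ℂ] H) :
    IsAntipode S ↔ conv S LinearMap.id = cone ∧ conv LinearMap.id S = cone := by
  simp only [IsAntipode, LinearMap.ext_iff]
  rfl

lemma lTensor_epsL_D (x : H ⊗[ℂ] H) : LinearMap.lTensor H epsL (D x) = x := by
  have h := νinv_cone (H := H)
  have h2 : (LinearMap.mul' ℂ H ∘ₗ LinearMap.rTensor H cone : H ⊗[ℂ] H →ₗ[ℂ] H) = epsL := by
    apply TensorProduct.ext'
    intro a b
    simp [epsL, cone]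
  rw [← h2, ← νinv_eq_D, h]
  rfl

lemma D_ν (x : H ⊗[ℂ] H) : D (ν H x) = LinearMap.lTensor H (ν H) (D x) := by
  induction x with
  | zero => simp
  | add x y hx hy => simp only [map_add, hx, hy]
  | tmul a b =>
    have h1 : D (a ⊗ₜ[ℂ] b) = LinearMap.lTensor H ((TensorProduct.mk ℂ H H).flip b)
        (Coalgebra.comul (R := ℂ) a) := by
      simp only [D, LinearMap.comp_apply, LinearMap.rTensor_tmul, LinearEquiv.coe_coe]
      induction (Coalgebra.comul (R := ℂ) a) with
      | zero => simp
      | add x y hx hy => simp only [map_add, TensorProduct.add_tmul, hx, hy]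
      | tmul c d => simp
    rw [h1, ν_eq, νinv_tmul, D_lTensor, D_comul,
      ← LinearMap.lTensor_comp_apply, ← LinearMap.lTensor_comp_apply]
    congr 2
    ext x
    simp [νinv_tmul]

lemma ν_mulRight (c : H) (x : H ⊗[ℂ] H) :
    ν H (LinearMap.lTensor H (LinearMap.mulRight ℂ c) x) =
      LinearMap.lTensor H (LinearMap.mulRight ℂ c) (ν H x) := by
  induction x with
  | zero => simp
  | add x y hx hy => simp only [map_add, hx, hy]
  | tmul a b =>
    rw [LinearMap.lTensor_tmul, ν_eq, νinv_tmul, νinv_tmul, ← LinearMap.lTensor_comp_apply]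
    congr 2
    ext x
    simp [mul_assoc]

lemma exists_of_bijective (hb : Function.Bijective (ν H)) :
    ∃ S : H →ₗ[ℂ] H, IsAntipode S := by
  let e := LinearEquiv.ofBijective (ν H) hb
  let φ : H ⊗[ℂ] H →ₗ[ℂ] H ⊗[ℂ] H := e.symm.toLinearMap
  have h1 : ∀ x, ν H (φ x) = x := fun x => e.apply_symm_apply x
  have h2 : ∀ x, φ (ν H x) = x := fun x => e.symm_apply_apply x
  have hφν : φ ∘ₗ ν H = LinearMap.id := LinearMap.ext h2
  have hνφ : ν H ∘ₗ φ = LinearMap.id := LinearMap.ext h1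
  have hD : ∀ x, D (φ x) = LinearMap.lTensor H φ (D x) := by
    intro x
    obtain ⟨y, rfl⟩ := hb.2 x
    rw [h2, D_ν, ← LinearMap.comp_apply, ← LinearMap.lTensor_comp, hφν]
    simp
  have hM : ∀ c x, φ (LinearMap.lTensor H (LinearMap.mulRight ℂ c) x) =
      LinearMap.lTensor H (LinearMap.mulRight ℂ c) (φ x) := by
    intro c x
    obtain ⟨y, rfl⟩ := hb.2 x
    rw [h2, ← ν_mulRight, h2]
  let S : H →ₗ[ℂ] H := epsL ∘ₗ φ ∘ₗ (TensorProduct.mk ℂ H H).flip 1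
  have hS : φ = νinv H S := by
    have key : ∀ x, φ x = LinearMap.lTensor H (epsL ∘ₗ φ) (D x) := by
      intro x
      rw [LinearMap.lTensor_comp, LinearMap.comp_apply, ← hD, lTensor_epsL_D]
    have hE : ∀ c x, epsL (LinearMap.lTensor H (LinearMap.mulRight ℂ c) x) =
        (epsL x : H) * c := by
      intro c x
      induction x with
      | zero => simp
      | add x y hx hy => simp only [map_add, hx, hy, add_mul]
      | tmul a b => simp [epsL]
    ext1
    ext a b
    change φ (a ⊗ₜ b) = νinv H S (a ⊗ₜ b)
    rw [key, νinv_eq_D]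
    congr 2
    apply TensorProduct.ext'
    intro c d
    have := hM d (c ⊗ₜ 1)
    simp only [LinearMap.lTensor_tmul, LinearMap.mulRight_apply, one_mul] at this
    simp only [LinearMap.comp_apply, this, hE]
    simp [S]
  refine ⟨S, (isAntipode_iff S).2 ⟨νinv_injective ?_, νinv_injective ?_⟩⟩
  · rw [← νinv_comp, νinv_cone, ← hS, ← ν_eq, hφν]
  · rw [← νinv_comp, νinv_cone, ← hS, ← ν_eq, hνφ]

lemma inv_of_antipode (S : H →ₗ[ℂ] H) (h : IsAntipode S) :
    νinv H S ∘ₗ ν H = LinearMap.id ∧ ν H ∘ₗ νinv H S = LinearMap.id := by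
  obtain ⟨h1, h2⟩ := (isAntipode_iff S).1 h
  rw [ν_eq, νinv_comp, νinv_comp, h1, h2, νinv_cone]
  exact ⟨rfl, rfl⟩

variable (H)

theorem nu_bijective_iff_hopf :
    (Function.Bijective (ν H) ↔ ∃ S : H →ₗ[ℂ] H, IsAntipode S) ∧
    (∀ S : H →ₗ[ℂ] H, IsAntipode S →
      νinv H S ∘ₗ ν H = LinearMap.id ∧ ν H ∘ₗ νinv H S = LinearMap.id) := by
  refine ⟨⟨exists_of_bijective, ?_⟩, inv_of_antipode⟩
  rintro ⟨S, hS⟩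
  obtain ⟨h1, h2⟩ := inv_of_antipode S hS
  exact Function.bijective_iff_has_inverse.2
    ⟨νinv H S, fun x => LinearMap.congr_fun h1 x, fun x => LinearMap.congr_fun h2 x⟩

end Stmt1
end
end

section
/- Let G be a groupoid and θ a cyclic structure on G. For each n ≥ 1, the cyclic operator τ_n on the nerve G_n, defined by τ_n(g₁,…,g_n) = (θ_{s(g_n)}·g_n⁻¹·g_{n-1}⁻¹⋯g₁⁻¹, g₁,…,g_{n-1}), is well defined (its first entry is composable with g₁) and satisfies τ_n^{n+1} = id on G_n. -/
/-!
STATEMENT 5: For a groupoid `G` with a cyclic structure `θ`, the cyclic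
operator `τ_n (g₁, …, g_n) = (θ_{s(g_n)} g_n⁻¹ g_{n-1}⁻¹ ⋯ g₁⁻¹, g₁, …, g_{n-1})`
is well defined on the nerve `G_n` and satisfies `τ_n^{n+1} = id` there.
-/

namespace Stmt5

/-- A groupoid together with a cyclic structure `θ`, presented single-sortedly:
a set of objects, a set of morphisms with source and target maps, a (totalized)
composition `comp g h` which is meaningful when `s g = t h` (`comp g h = g ∘ h`),
identities, inverses, and a family `θ_A ∈ Mor(A, A)` with `f θ_{s f} = θ_{t f} f`. -/
structure CyclicGroupoid where
  Obj : Type*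
  Mor : Type*
  s : Mor → Obj
  t : Mor → Obj
  comp : Mor → Mor → Mor
  ide : Obj → Mor
  inv : Mor → Mor
  s_comp : ∀ g h, s g = t h → s (comp g h) = s h
  t_comp : ∀ g h, s g = t h → t (comp g h) = t g
  comp_assoc : ∀ g h k, s g = t h → s h = t k →
    comp (comp g h) k = comp g (comp h k)
  s_ide : ∀ A, s (ide A) = A
  t_ide : ∀ A, t (ide A) = A
  comp_ide : ∀ g, comp g (ide (s g)) = g
  ide_comp : ∀ g, comp (ide (t g)) g = g
  s_inv : ∀ g, s (inv g) = t g
  t_inv : ∀ g, t (inv g) = s g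
  inv_comp : ∀ g, comp (inv g) g = ide (s g)
  comp_inv : ∀ g, comp g (inv g) = ide (t g)
  θ : Obj → Mor
  s_θ : ∀ A, s (θ A) = A
  t_θ : ∀ A, t (θ A) = A
  θ_natural : ∀ f, comp f (θ (s f)) = comp (θ (t f)) f

variable (G : CyclicGroupoid)

/-- `g` is an element of the nerve `G_n` (tuples of length `n + 1` here):
consecutive morphisms are composable, `s (gᵢ) = t (g_{i+1})`. -/
def IsNerve {n : ℕ} (g : Fin (n + 1) → G.Mor) : Prop :=
  ∀ i j : Fin (n + 1), (j : ℕ) = (i : ℕ) + 1 → G.s (g i) = G.t (g j)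

/-- The composite `g_n⁻¹ g_{n-1}⁻¹ ⋯ g₁⁻¹` (for a tuple `(g₁, …, g_n)` of
length `n + 1`, indexed by `Fin (n+1)`). -/
def invChain {n : ℕ} (g : Fin (n + 1) → G.Mor) : G.Mor :=
  ((List.ofFn fun j => G.inv (g j)).reverse).foldl G.comp
    (G.ide (G.s (g (Fin.last n))))

/-- The cyclic operator
`τ (g₁, …, g_n) = (θ_{s(g_n)} g_n⁻¹ ⋯ g₁⁻¹, g₁, …, g_{n-1})`. -/
def tau {n : ℕ} (g : Fin (n + 1) → G.Mor) : Fin (n + 1) → G.Mor :=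
  fun i => if i = 0 then G.comp (G.θ (G.s (g (Fin.last n)))) (invChain G g)
    else g (i - 1)

theorem abs_key (l c x : G.Mor) (h : G.t l = G.t c)
    (hx : x = G.comp (G.θ (G.s l)) (G.comp (G.inv l) c)) :
    G.comp (G.θ (G.t c)) (G.comp c (G.inv x)) = l := by
  have h1 : G.s (G.inv l) = G.t c := by rw [G.s_inv, h]
  have h2 : G.s (G.θ (G.s l)) = G.t (G.comp (G.inv l) c) := by
    rw [G.s_θ, G.t_comp _ _ h1, G.t_inv]
  have sx : G.s x = G.s c := by rw [hx, G.s_comp _ _ h2, G.s_comp _ _ h1]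
  have tx : G.t x = G.s l := by rw [hx, G.t_comp _ _ h2, G.t_θ]
  have e : G.comp l x = G.comp (G.θ (G.t c)) c := by
    rw [hx, ← G.comp_assoc _ _ _ (G.t_θ _).symm h2, G.θ_natural,
      G.comp_assoc _ _ _ (G.s_θ _) (by rw [G.t_comp _ _ h1, G.t_inv]),
      ← G.comp_assoc l _ _ (G.t_inv _).symm h1, G.comp_inv, h, G.ide_comp]
  rw [← G.comp_assoc _ _ _ (G.s_θ _) (by rw [G.t_inv, sx]), ← e,
    G.comp_assoc _ _ _ tx.symm (G.t_inv _).symm, G.comp_inv, tx, G.comp_ide]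

theorem invChain_zero (g : Fin 1 → G.Mor) : invChain G g = G.inv (g 0) := by
  simp only [invChain, List.ofFn_succ, List.ofFn_zero, List.reverse_cons, List.reverse_nil,
    List.nil_append, List.foldl_cons, List.foldl_nil]
  have := G.ide_comp (G.inv (g 0))
  rwa [G.t_inv] at this

theorem invChain_succ {n : ℕ} (g : Fin (n + 2) → G.Mor) :
    invChain G g = G.comp (invChain G (fun i : Fin (n + 1) => g i.succ)) (G.inv (g 0)) := by
  unfold invChain
  rw [List.ofFn_succ, List.reverse_cons, List.foldl_append]
  rfl

theorem isNerve_tail {n : ℕ} {g : Fin (n + 2) → G.Mor} (hg : IsNerve G g) :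
    IsNerve G (fun i : Fin (n + 1) => g i.succ) :=
  fun i j h => hg _ _ (by simp [h])

theorem isNerve_init {n : ℕ} {g : Fin (n + 2) → G.Mor} (hg : IsNerve G g) :
    IsNerve G (fun i : Fin (n + 1) => g i.castSucc) :=
  fun i j h => hg _ _ (by simp [h])

theorem st_invChain {n : ℕ} (g : Fin (n + 1) → G.Mor) (hg : IsNerve G g) :
    G.s (invChain G g) = G.t (g 0) ∧ G.t (invChain G g) = G.s (g (Fin.last n)) := by
  induction n with
  | zero => rw [invChain_zero, G.s_inv, G.t_inv]; exact ⟨rfl, rfl⟩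
  | succ n ih =>
    obtain ⟨h1, h2⟩ := ih _ (isNerve_tail G hg)
    have h : G.s (invChain G (fun i : Fin (n + 1) => g i.succ)) = G.t (G.inv (g 0)) := by
      rw [h1, G.t_inv]; exact (hg _ _ (by simp)).symm
    rw [invChain_succ, G.s_comp _ _ h, G.t_comp _ _ h, h2, G.s_inv]
    exact ⟨rfl, rfl⟩

theorem invChain_last {n : ℕ} (g : Fin (n + 2) → G.Mor) (hg : IsNerve G g) :
    invChain G g = G.comp (G.inv (g (Fin.last (n + 1))))
      (invChain G (fun i : Fin (n + 1) => g i.castSucc)) := by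
  induction n with
  | zero => rw [invChain_succ, invChain_zero, invChain_zero]; rfl
  | succ n ih =>
    rw [invChain_succ, ih _ (isNerve_tail G hg),
      invChain_succ G (fun i : Fin (n + 2) => g i.castSucc)]
    obtain ⟨h1, h2⟩ := st_invChain G _ (isNerve_tail G (isNerve_init G hg))
    refine G.comp_assoc _ _ _ ?_ ?_
    · rw [G.s_inv]; exact (h2.trans (hg _ _ (by simp))).symm
    · rw [G.t_inv]; exact h1.trans (hg _ _ (by simp)).symm

theorem tau_zero {n : ℕ} (g : Fin (n + 1) → G.Mor) :
    tau G g 0 = G.comp (G.θ (G.s (g (Fin.last n)))) (invChain G g) := by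
  simp [tau]

theorem tau_mk {n : ℕ} (g : Fin (n + 1) → G.Mor) (i : ℕ) (h : i + 1 < n + 1) :
    tau G g ⟨i + 1, h⟩ = g ⟨i, by omega⟩ := by
  have h0 : (⟨i + 1, h⟩ : Fin (n + 1)) ≠ 0 := by simp [Fin.ext_iff]
  simp only [tau, h0, if_false]
  congr 1
  rw [Fin.ext_iff, Fin.val_sub_one_of_ne_zero h0]
  simp

theorem isNerve_tau {n : ℕ} (g : Fin (n + 1) → G.Mor) (hg : IsNerve G g) :
    IsNerve G (tau G g) := by
  rintro ⟨i, hi⟩ ⟨j, hj⟩ h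
  simp only at h
  subst h
  rw [tau_mk]
  cases i with
  | zero =>
    obtain ⟨h1, h2⟩ := st_invChain G g hg
    have : G.s (tau G g 0) = G.t (g 0) := by
      rw [tau_zero, G.s_comp _ _ (by rw [G.s_θ, h2]), h1]
    exact this
  | succ i => rw [tau_mk]; exact hg _ _ rfl

theorem tau_tau_zero {n : ℕ} (g : Fin (n + 1) → G.Mor) (hg : IsNerve G g) :
    tau G (tau G g) 0 = g (Fin.last n) := by
  have hx := tau_zero G g
  rw [tau_zero G (tau G g)]
  cases n with
  | zero =>
    obtain ⟨h1, h2⟩ := st_invChain G g hg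
    have sx : G.s (tau G g 0) = G.t (g 0) := by
      rw [tau_zero, G.s_comp _ _ (by rw [G.s_θ, h2]), h1]
    rw [invChain_zero] at hx ⊢
    have e := G.comp_ide (G.inv (g 0))
    rw [G.s_inv] at e
    have e2 := G.ide_comp (G.inv (tau G g 0))
    rw [G.t_inv, sx] at e2
    have k := abs_key G (g 0) (G.ide (G.t (g 0))) (tau G g 0) (G.t_ide _).symm (by rw [e]; exact hx)
    rw [e2, G.t_ide, ← sx] at k
    exact k
  | succ n =>
    obtain ⟨h1, h2⟩ := st_invChain G _ (isNerve_init G hg)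
    have hl : G.s (g (Fin.last n).castSucc) = G.t (g (Fin.last (n + 1))) := hg _ _ (by simp)
    rw [invChain_last G g hg] at hx
    have k := abs_key G _ _ _ (hl.symm.trans h2.symm) hx
    have ht : (fun i : Fin (n + 1) => tau G g i.succ) = fun i => g i.castSucc := by
      funext i
      exact tau_mk G g i (by omega)
    have hs : tau G g (Fin.last (n + 1)) = g (Fin.last n).castSucc :=
      tau_mk G g n (by omega)
    rw [invChain_succ, ht, hs, ← h2]
    exact k

theorem tau_iter {n : ℕ} (m : ℕ) : ∀ (g : Fin (n + 1) → G.Mor) (i : ℕ) (h : i + m < n + 1),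
    (tau G)^[m] g ⟨i + m, h⟩ = g ⟨i, by omega⟩ := by
  induction m with
  | zero => intro g i h; rfl
  | succ m ih =>
    intro g i h
    rw [Function.iterate_succ_apply']
    exact (tau_mk G _ (i + m) h).trans (ih g i (by omega))

theorem isNerve_iter {n : ℕ} (g : Fin (n + 1) → G.Mor) (hg : IsNerve G g) (m : ℕ) :
    IsNerve G ((tau G)^[m] g) := by
  induction m with
  | zero => exact hg
  | succ m ih => rw [Function.iterate_succ_apply']; exact isNerve_tau G _ ih

theorem tau_wellDefined_and_iterate {n : ℕ} (g : Fin (n + 1) → G.Mor)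
    (hg : IsNerve G g) :
    IsNerve G (tau G g) ∧ (tau G)^[n + 2] g = g := by
  refine ⟨isNerve_tau G g hg, ?_⟩
  funext ⟨i, hi⟩
  obtain ⟨k, rfl⟩ : ∃ k, n = i + k := ⟨n - i, by omega⟩
  have e : i + k + 2 = i + (k + 2) := by omega
  rw [e, Function.iterate_add_apply]
  have h1 := tau_iter G i ((tau G)^[k + 2] g) 0 (by omega)
  have h2 := tau_tau_zero G _ (isNerve_iter G g hg k)
  have h3 := tau_iter G k g i (by omega)
  rw [← Function.iterate_succ_apply' (tau G), ← Function.iterate_succ_apply' (tau G)] at h2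
  simp only [Nat.zero_add] at h1
  exact h1.trans (h2.trans h3)

end Stmt5
end

section
/- Let G be a groupoid and θ a cyclic structure on G. For n ≥ 1 let C_n := {(g₀, g₁,…,g_n) : s(g_i) = t(g_{i+1}) for 0 ≤ i ≤ n−1, s(g_n) = t(g₀), and g₀g₁⋯g_n = θ_{s(g_n)}}. Then the map I : C_n → G_n, I(g₀,…,g_n) = (g₁,…,g_n), is a bijection onto the nerve G_n, with inverse I⁻¹(g₁,…,g_n) = (θ_{s(g_n)}·(g₁g₂⋯g_n)⁻¹, g₁,…,g_n), and I intertwines the cyclic operators: I(g_n, g₀,…,g_{n−1}) = τ_n(I(g₀,…,g_n)), where τ_n(g₁,…,g_n) = (θ_{s(g_n)}·g_n⁻¹·g_{n-1}⁻¹⋯g₁⁻¹, g₁,…,g_{n-1}). -/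
/-!
STATEMENT 6: For a groupoid `G` with cyclic structure `θ` and `n ≥ 1`, the map
`I(g₀, …, g_n) = (g₁, …, g_n)` is a bijection from
`C_n = {(g₀, …, g_n) : composable, s(g_n) = t(g₀), g₀ ⋯ g_n = θ_{s(g_n)}}`
onto the nerve `G_n`, with inverse
`I⁻¹(g₁, …, g_n) = (θ_{s(g_n)} (g₁ ⋯ g_n)⁻¹, g₁, …, g_n)`, intertwining the
cyclic operators.

Here `n = k + 1`: elements of `C_n` are tuples indexed by `Fin (k + 2)` and
elements of `G_n` are tuples indexed by `Fin (k + 1)`.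
-/

namespace Stmt6

/-- A groupoid together with a cyclic structure `θ`, presented single-sortedly. -/
structure CyclicGroupoid where
  Obj : Type*
  Mor : Type*
  s : Mor → Obj
  t : Mor → Obj
  comp : Mor → Mor → Mor
  ide : Obj → Mor
  inv : Mor → Mor
  s_comp : ∀ g h, s g = t h → s (comp g h) = s h
  t_comp : ∀ g h, s g = t h → t (comp g h) = t g
  comp_assoc : ∀ g h k, s g = t h → s h = t k →
    comp (comp g h) k = comp g (comp h k)
  s_ide : ∀ A, s (ide A) = A
  t_ide : ∀ A, t (ide A) = A
  comp_ide : ∀ g, comp g (ide (s g)) = g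
  ide_comp : ∀ g, comp (ide (t g)) g = g
  s_inv : ∀ g, s (inv g) = t g
  t_inv : ∀ g, t (inv g) = s g
  inv_comp : ∀ g, comp (inv g) g = ide (s g)
  comp_inv : ∀ g, comp g (inv g) = ide (t g)
  θ : Obj → Mor
  s_θ : ∀ A, s (θ A) = A
  t_θ : ∀ A, t (θ A) = A
  θ_natural : ∀ f, comp f (θ (s f)) = comp (θ (t f)) f

variable (G : CyclicGroupoid)

/-- Consecutive composability of a tuple of morphisms. -/
def Composable {m : ℕ} (g : Fin m → G.Mor) : Prop :=
  ∀ i j : Fin m, (j : ℕ) = (i : ℕ) + 1 → G.s (g i) = G.t (g j)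

/-- The nerve `G_n` (tuples of length `k + 1`). -/
def IsNerve {k : ℕ} (g : Fin (k + 1) → G.Mor) : Prop :=
  Composable G g

/-- The (left-nested) product `g₀ g₁ ⋯ g_m` of all entries of a tuple. -/
def prodAll {m : ℕ} (g : Fin (m + 1) → G.Mor) : G.Mor :=
  (List.ofFn g).foldl G.comp (G.ide (G.t (g 0)))

/-- Membership in
`C_n = {(g₀, …, g_n) : s(gᵢ) = t(g_{i+1}), s(g_n) = t(g₀), g₀ g₁ ⋯ g_n = θ_{s(g_n)}}`,
for tuples of length `k + 2` (so `n = k + 1`). -/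
def IsC {k : ℕ} (c : Fin (k + 2) → G.Mor) : Prop :=
  Composable G c ∧ G.s (c (Fin.last (k + 1))) = G.t (c 0) ∧
    prodAll G c = G.θ (G.s (c (Fin.last (k + 1))))

/-- `I (g₀, …, g_n) = (g₁, …, g_n)`. -/
def I {k : ℕ} (c : Fin (k + 2) → G.Mor) : Fin (k + 1) → G.Mor :=
  fun i => c i.succ

/-- `I⁻¹ (g₁, …, g_n) = (θ_{s(g_n)} (g₁ g₂ ⋯ g_n)⁻¹, g₁, …, g_n)`. -/
def Iinv {k : ℕ} (g : Fin (k + 1) → G.Mor) : Fin (k + 2) → G.Mor :=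
  fun i => if h : i = 0 then G.comp (G.θ (G.s (g (Fin.last k)))) (G.inv (prodAll G g))
    else g (i.pred h)

/-- The composite `g_n⁻¹ g_{n-1}⁻¹ ⋯ g₁⁻¹`. -/
def invChain {k : ℕ} (g : Fin (k + 1) → G.Mor) : G.Mor :=
  ((List.ofFn fun j => G.inv (g j)).reverse).foldl G.comp
    (G.ide (G.s (g (Fin.last k))))

/-- The cyclic operator on the nerve,
`τ (g₁, …, g_n) = (θ_{s(g_n)} g_n⁻¹ ⋯ g₁⁻¹, g₁, …, g_{n-1})`. -/
def tau {k : ℕ} (g : Fin (k + 1) → G.Mor) : Fin (k + 1) → G.Mor :=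
  fun i => if i = 0 then G.comp (G.θ (G.s (g (Fin.last k)))) (invChain G g)
    else g (i - 1)

/-- The cyclic shift `(g₀, …, g_n) ↦ (g_n, g₀, …, g_{n-1})` on `C_n`. -/
def cshift {k : ℕ} (c : Fin (k + 2) → G.Mor) : Fin (k + 2) → G.Mor :=
  fun i => if i = 0 then c (Fin.last (k + 1)) else c (i - 1)

theorem inv_unique (a b : G.Mor) (h : G.s a = G.t b) (hab : G.comp a b = G.ide (G.s b)) :
    a = G.inv b := by
  have h1 : G.comp (G.comp a b) (G.inv b) = G.comp a (G.comp b (G.inv b)) :=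
    G.comp_assoc _ _ _ h (G.t_inv b).symm
  rw [G.comp_inv, ← h, G.comp_ide, hab, ← G.t_inv, G.ide_comp] at h1
  exact h1.symm

theorem inv_comp_eq (a b : G.Mor) (h : G.s a = G.t b) :
    G.comp (G.inv b) (G.inv a) = G.inv (G.comp a b) := by
  have e1 : G.s (G.inv b) = G.t (G.inv a) := by rw [G.s_inv, G.t_inv, h]
  apply inv_unique
  · rw [G.s_comp _ _ e1, G.s_inv, G.t_comp _ _ h]
  · rw [G.comp_assoc _ _ _ e1 (by rw [G.s_inv, G.t_comp _ _ h]),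
      ← G.comp_assoc _ _ _ (G.s_inv a) h, G.inv_comp, h, G.ide_comp, G.inv_comp,
      G.s_comp _ _ h]

theorem prodAll_zero (g : Fin 1 → G.Mor) : prodAll G g = g 0 := by
  simp [prodAll, G.ide_comp]

theorem prodAll_snoc {m : ℕ} (g : Fin (m + 2) → G.Mor) :
    prodAll G g = G.comp (prodAll G (fun i : Fin (m + 1) => g i.castSucc)) (g (Fin.last (m + 1))) := by
  unfold prodAll
  rw [List.ofFn_succ_last, List.foldl_append]
  simp

theorem comp_init {m : ℕ} {g : Fin (m + 2) → G.Mor} (h : Composable G g) :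
    Composable G (fun i : Fin (m + 1) => g i.castSucc) := by
  intro i j hij
  exact h _ _ (by simpa using hij)

theorem comp_tail {m : ℕ} {g : Fin (m + 2) → G.Mor} (h : Composable G g) :
    Composable G (I G g) := by
  intro i j hij
  exact h _ _ (by simpa using hij)

theorem prodAll_st {m : ℕ} (g : Fin (m + 1) → G.Mor) (h : Composable G g) :
    G.s (prodAll G g) = G.s (g (Fin.last m)) ∧ G.t (prodAll G g) = G.t (g 0) := by
  induction m with
  | zero => rw [prodAll_zero]; exact ⟨rfl, rfl⟩
  | succ m ih =>
    obtain ⟨h1, h2⟩ := ih _ (comp_init G h)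
    have e := h (Fin.last m).castSucc (Fin.last (m + 1)) (by simp)
    rw [prodAll_snoc, G.s_comp _ _ (h1.trans e), G.t_comp _ _ (h1.trans e)]
    exact ⟨rfl, h2⟩

theorem prodAll_cons {m : ℕ} (g : Fin (m + 2) → G.Mor) (h : Composable G g) :
    prodAll G g = G.comp (g 0) (prodAll G (I G g)) := by
  induction m with
  | zero => rw [prodAll_snoc, prodAll_zero, prodAll_zero]; rfl
  | succ m ih =>
    rw [prodAll_snoc, ih _ (comp_init G h), prodAll_snoc G (I G g)]
    obtain ⟨h1, h2⟩ := prodAll_st G _ (comp_tail G (comp_init G h))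
    refine G.comp_assoc _ _ _ (Eq.trans ?_ h2.symm) (h1.trans ?_)
    · exact h _ _ (by simp)
    · exact h _ _ (by simp)

theorem invChain_eq {m : ℕ} (g : Fin (m + 1) → G.Mor) (h : Composable G g) :
    invChain G g = G.inv (prodAll G g) := by
  induction m with
  | zero =>
    rw [prodAll_zero]
    simp only [invChain, List.ofFn_succ, List.ofFn_zero, List.reverse_cons, List.reverse_nil,
      List.nil_append, List.foldl_cons, List.foldl_nil]
    rw [← G.t_inv]
    exact G.ide_comp _
  | succ m ih =>
    have e : invChain G g = G.comp (invChain G (I G g)) (G.inv (g 0)) := by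
      unfold invChain
      rw [List.ofFn_succ, List.reverse_cons, List.foldl_append]
      simp [I]
    rw [e, ih _ (comp_tail G h), prodAll_cons G g h, inv_comp_eq]
    rw [(prodAll_st G _ (comp_tail G h)).2]
    exact h _ _ (by simp)

theorem I_Iinv {k : ℕ} (g : Fin (k + 1) → G.Mor) : I G (Iinv G g) = g := by
  funext i
  simp [I, Iinv]

theorem head_eq {k : ℕ} (c : Fin (k + 2) → G.Mor) (h : IsC G c) :
    c 0 = G.comp (G.θ (G.s (I G c (Fin.last k)))) (G.inv (prodAll G (I G c))) := by
  obtain ⟨h1, h2, h3⟩ := h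
  have e : G.s (c 0) = G.t (prodAll G (I G c)) := by
    rw [(prodAll_st G _ (comp_tail G h1)).2]
    exact h1 _ _ (by simp)
  have e2 : I G c (Fin.last k) = c (Fin.last (k + 1)) := rfl
  rw [e2, ← h3, prodAll_cons G c h1, G.comp_assoc _ _ _ e (G.t_inv _).symm, G.comp_inv, ← e,
    G.comp_ide]

theorem Iinv_isC {k : ℕ} (g : Fin (k + 1) → G.Mor) (h : Composable G g) : IsC G (Iinv G g) := by
  obtain ⟨p1, p2⟩ := prodAll_st G g h
  have e0 : Iinv G g 0 = G.comp (G.θ (G.s (g (Fin.last k)))) (G.inv (prodAll G g)) := by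
    simp [Iinv]
  have es : ∀ i : Fin (k + 1), Iinv G g i.succ = g i := fun i => congrFun (I_Iinv G g) i
  have el : Iinv G g (Fin.last (k + 1)) = g (Fin.last k) := es (Fin.last k)
  have c1 : G.s (G.θ (G.s (g (Fin.last k)))) = G.t (G.inv (prodAll G g)) := by
    rw [G.s_θ, G.t_inv, p1]
  have hc : Composable G (Iinv G g) := by
    intro i j hij
    induction j using Fin.cases with
    | zero => simp at hij
    | succ j =>
      rw [es]
      induction i using Fin.cases with
      | zero =>
        have : j = 0 := by
          apply Fin.ext
          simpa using hij
        rw [e0, G.s_comp _ _ c1, G.s_inv, p2, this]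
      | succ i =>
        rw [es]
        exact h _ _ (by simpa using hij)
  refine ⟨hc, ?_, ?_⟩
  · rw [el, e0, G.t_comp _ _ c1, G.t_θ]
  · rw [prodAll_cons G _ hc, I_Iinv, el, e0, G.comp_assoc _ _ _ c1 (G.s_inv _), G.inv_comp, p1]
    have := G.comp_ide (G.θ (G.s (g (Fin.last k))))
    rwa [G.s_θ] at this

theorem I_bijection_intertwines {k : ℕ} :
    (∀ c : Fin (k + 2) → G.Mor, IsC G c → IsNerve G (I G c)) ∧
    (∀ g : Fin (k + 1) → G.Mor, IsNerve G g → IsC G (Iinv G g)) ∧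
    (∀ c : Fin (k + 2) → G.Mor, IsC G c → Iinv G (I G c) = c) ∧
    (∀ g : Fin (k + 1) → G.Mor, IsNerve G g → I G (Iinv G g) = g) ∧
    (∀ c : Fin (k + 2) → G.Mor, IsC G c → I G (cshift G c) = tau G (I G c)) := by
  refine ⟨fun c h => comp_tail G h.1, fun g h => Iinv_isC G g h, ?_, fun g _ => I_Iinv G g, ?_⟩
  · intro c h
    funext i
    induction i using Fin.cases with
    | zero => rw [head_eq G c h]; simp [Iinv]
    | succ i => exact congrFun (I_Iinv G (I G c)) i
  · intro c h
    have key : ∀ {m : ℕ} (i : Fin (m + 1)), i.succ - 1 = i.castSucc := by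
      intro m i
      rw [sub_eq_iff_eq_add]
      exact Fin.coeSucc_eq_succ.symm
    funext i
    have e1 : I G (cshift G c) i = c i.castSucc := by
      simp [I, cshift, key]
    rw [e1]
    unfold tau
    split_ifs with hi
    · subst hi
      rw [invChain_eq G _ (comp_tail G h.1)]
      exact head_eq G c h
    · obtain ⟨j, rfl⟩ := Fin.exists_succ_eq.mpr hi
      obtain _ | k := k
      · exact j.elim0
      · rw [key]
        rfl

end Stmt6
end

section
/- In the Hopf–Galois coextension setting, for all c ∈ C and h, g ∈ H the element c⁽¹⁾·h ⊗ c⁽²⁾·g lies in C□_D C, and κ(c⁽¹⁾·h ⊗ c⁽²⁾·g) = ε(c)·S(h)g. -/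
open TensorProduct

noncomputable section

namespace Gal

variable (C D H : Type*) [Ring H] [HopfAlgebra ℂ H]
  [AddCommGroup C] [Module ℂ C] [Coalgebra ℂ C]
  [AddCommGroup D] [Module ℂ D] [Coalgebra ℂ D]

/-- `c ⊗ c' ↦ c⁽¹⁾ ⊗ (π(c⁽²⁾) ⊗ c')`. -/
def cotL (π : C →ₗ[ℂ] D) : C ⊗[ℂ] C →ₗ[ℂ] C ⊗[ℂ] (D ⊗[ℂ] C) :=
  (TensorProduct.assoc ℂ C D C).toLinearMap
    ∘ₗ LinearMap.rTensor C (LinearMap.lTensor C π ∘ₗ Coalgebra.comul (R := ℂ))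

/-- `c ⊗ c' ↦ c ⊗ (π(c'⁽¹⁾) ⊗ c'⁽²⁾)`. -/
def cotR (π : C →ₗ[ℂ] D) : C ⊗[ℂ] C →ₗ[ℂ] C ⊗[ℂ] (D ⊗[ℂ] C) :=
  LinearMap.lTensor C (LinearMap.rTensor C π ∘ₗ Coalgebra.comul (R := ℂ))

/-- The cotensor product `C □_D C` as a subspace of `C ⊗ C`. -/
def cot (π : C →ₗ[ℂ] D) : Submodule ℂ (C ⊗[ℂ] C) :=
  LinearMap.eqLocus (cotL C D π) (cotR C D π)

/-- The canonical map `β : C ⊗ H → C ⊗ C`, `c ⊗ h ↦ c⁽¹⁾ ⊗ c⁽²⁾ · h`. -/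
def βcan (act : C ⊗[ℂ] H →ₗ[ℂ] C) : C ⊗[ℂ] H →ₗ[ℂ] C ⊗[ℂ] C :=
  LinearMap.lTensor C act ∘ₗ (TensorProduct.assoc ℂ C C H).toLinearMap
    ∘ₗ LinearMap.rTensor H (Coalgebra.comul (R := ℂ))

/-- `κ = (ε ⊗ id_H) ∘ β⁻¹ : C □_D C → H` (computed with a linear extension of
`β⁻¹` to all of `C ⊗ C`; on `C □_D C` it does not depend on the extension). -/
def κ (βinv : C ⊗[ℂ] C →ₗ[ℂ] C ⊗[ℂ] H) : C ⊗[ℂ] C →ₗ[ℂ] H :=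
  (TensorProduct.lid ℂ H).toLinearMap
    ∘ₗ LinearMap.rTensor H (Coalgebra.counit (R := ℂ)) ∘ₗ βinv

/-- The Hopf–Galois coextension setting: `C` is a right `H`-module coalgebra
via `act`, `π : C → D` is a surjective coalgebra map whose kernel is spanned by
`{c · h - ε(h) c}`, the canonical map `β` is injective with image exactly
`C □_D C`, and `βinv` is a linear map restricting on `C □_D C` to the inverse
of (the corestriction of) `β`. -/
structure IsGaloisCoextension (act : C ⊗[ℂ] H →ₗ[ℂ] C) (π : C →ₗ[ℂ] D)
    (βinv : C ⊗[ℂ] C →ₗ[ℂ] C ⊗[ℂ] H) : Prop where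
  act_one : ∀ c : C, act (c ⊗ₜ[ℂ] 1) = c
  act_mul : ∀ (c : C) (h h' : H),
    act (act (c ⊗ₜ[ℂ] h) ⊗ₜ[ℂ] h') = act (c ⊗ₜ[ℂ] (h * h'))
  comul_act : Coalgebra.comul (R := ℂ) ∘ₗ act
    = TensorProduct.map act act
        ∘ₗ (TensorProduct.tensorTensorTensorComm ℂ C C H H).toLinearMap
        ∘ₗ TensorProduct.map (Coalgebra.comul (R := ℂ)) (Coalgebra.comul (R := ℂ))
  counit_act : Coalgebra.counit (R := ℂ) ∘ₗ act
    = LinearMap.mul' ℂ ℂ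
        ∘ₗ TensorProduct.map (Coalgebra.counit (R := ℂ)) (Coalgebra.counit (R := ℂ))
  comul_π : Coalgebra.comul (R := ℂ) ∘ₗ π
    = TensorProduct.map π π ∘ₗ Coalgebra.comul (R := ℂ)
  counit_π : Coalgebra.counit (R := ℂ) ∘ₗ π = Coalgebra.counit (R := ℂ)
  π_surjective : Function.Surjective π
  ker_π : LinearMap.ker π
    = Submodule.span ℂ {x : C | ∃ (c : C) (h : H),
        x = act (c ⊗ₜ[ℂ] h) - (Coalgebra.counit (R := ℂ) h) • c}
  β_mem_cot : ∀ y : C ⊗[ℂ] H, βcan C H act y ∈ cot C D π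
  βinv_β : ∀ y : C ⊗[ℂ] H, βinv (βcan C H act y) = y
  β_βinv : ∀ x ∈ cot C D π, βcan C H act (βinv x) = x


theorem aux_assoc {C H : Type*} [Ring H] [HopfAlgebra ℂ H]
    [AddCommGroup C] [Module ℂ C]
    (act : C ⊗[ℂ] H →ₗ[ℂ] C)
    (hm : ∀ (c : C) (h h' : H), act (act (c ⊗ₜ[ℂ] h) ⊗ₜ[ℂ] h') = act (c ⊗ₜ[ℂ] (h * h')))
    (g b : H) (t : C ⊗[ℂ] C) (s : H ⊗[ℂ] H) :
    LinearMap.lTensor C act (TensorProduct.assoc ℂ C C H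
      ((TensorProduct.map act act (TensorProduct.tensorTensorTensorComm ℂ C C H H (t ⊗ₜ[ℂ] s)))
        ⊗ₜ[ℂ] (HopfAlgebra.antipode (R := ℂ) b * g)))
    = TensorProduct.map act act (TensorProduct.tensorTensorTensorComm ℂ C C H H (t ⊗ₜ[ℂ]
        (LinearMap.lTensor H (LinearMap.mulRight ℂ g ∘ₗ LinearMap.mul' ℂ H
          ∘ₗ LinearMap.lTensor H (HopfAlgebra.antipode (R := ℂ)))
          (TensorProduct.assoc ℂ H H H (s ⊗ₜ[ℂ] b))))) := by
  induction t with
  | zero => simp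
  | add x y hx hy => simp only [TensorProduct.add_tmul, map_add, hx, hy]
  | tmul x y =>
    induction s with
    | zero => simp
    | add u v hu hv => simp only [TensorProduct.add_tmul, TensorProduct.tmul_add, map_add, hu, hv]
    | tmul u v => simp [hm, mul_assoc]

theorem aux_hopf {H : Type*} [Ring H] [HopfAlgebra ℂ H] (g h : H) :
    LinearMap.lTensor H (LinearMap.mulRight ℂ g ∘ₗ LinearMap.mul' ℂ H
          ∘ₗ LinearMap.lTensor H (HopfAlgebra.antipode (R := ℂ)))
          (TensorProduct.assoc ℂ H H H
            (LinearMap.rTensor H (Coalgebra.comul (R := ℂ)) (Coalgebra.comul (R := ℂ) h)))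
      = h ⊗ₜ[ℂ] g := by
  rw [Coalgebra.coassoc_apply, ← LinearMap.comp_apply, ← LinearMap.lTensor_comp,
    LinearMap.comp_assoc, LinearMap.comp_assoc, HopfAlgebra.mul_antipode_lTensor_comul,
    ← LinearMap.comp_assoc, LinearMap.lTensor_comp, LinearMap.comp_apply,
    Coalgebra.lTensor_counit_comul]
  simp

theorem aux_beta {C H : Type*} [Ring H] [HopfAlgebra ℂ H]
    [AddCommGroup C] [Module ℂ C] [Coalgebra ℂ C]
    (act : C ⊗[ℂ] H →ₗ[ℂ] C)
    (hm : ∀ (c : C) (h h' : H), act (act (c ⊗ₜ[ℂ] h) ⊗ₜ[ℂ] h') = act (c ⊗ₜ[ℂ] (h * h')))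
    (hc : Coalgebra.comul (R := ℂ) ∘ₗ act
    = TensorProduct.map act act
        ∘ₗ (TensorProduct.tensorTensorTensorComm ℂ C C H H).toLinearMap
        ∘ₗ TensorProduct.map (Coalgebra.comul (R := ℂ)) (Coalgebra.comul (R := ℂ)))
    (c : C) (g : H) (u : H ⊗[ℂ] H) :
    βcan C H act (TensorProduct.map (act ∘ₗ TensorProduct.mk ℂ C H c)
      (LinearMap.mulRight ℂ g ∘ₗ HopfAlgebra.antipode (R := ℂ)) u)
    = TensorProduct.map act act (TensorProduct.tensorTensorTensorComm ℂ C C H H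
        ((Coalgebra.comul (R := ℂ) c) ⊗ₜ[ℂ]
        (LinearMap.lTensor H (LinearMap.mulRight ℂ g ∘ₗ LinearMap.mul' ℂ H
          ∘ₗ LinearMap.lTensor H (HopfAlgebra.antipode (R := ℂ)))
          (TensorProduct.assoc ℂ H H H
            (LinearMap.rTensor H (Coalgebra.comul (R := ℂ)) u))))) := by
  induction u with
  | zero => simp
  | add x y hx hy => simp only [TensorProduct.tmul_add, map_add, hx, hy]
  | tmul a b =>
    have h1 := LinearMap.congr_fun hc (c ⊗ₜ[ℂ] a)
    simp only [LinearMap.comp_apply, TensorProduct.map_tmul, LinearEquiv.coe_coe] at h1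
    rw [LinearMap.rTensor_tmul, ← aux_assoc act hm, ← h1]
    simp [βcan]

theorem aux_eps {C H : Type*} [Ring H] [HopfAlgebra ℂ H]
    [AddCommGroup C] [Module ℂ C] [Coalgebra ℂ C]
    (act : C ⊗[ℂ] H →ₗ[ℂ] C)
    (he : Coalgebra.counit (R := ℂ) ∘ₗ act
    = LinearMap.mul' ℂ ℂ
        ∘ₗ TensorProduct.map (Coalgebra.counit (R := ℂ)) (Coalgebra.counit (R := ℂ)))
    (c : C) (g : H) (u : H ⊗[ℂ] H) :
    TensorProduct.lid ℂ H (LinearMap.rTensor H (Coalgebra.counit (R := ℂ))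
      (TensorProduct.map (act ∘ₗ TensorProduct.mk ℂ C H c)
      (LinearMap.mulRight ℂ g ∘ₗ HopfAlgebra.antipode (R := ℂ)) u))
    = (Coalgebra.counit (R := ℂ) c) • (HopfAlgebra.antipode (R := ℂ)
        (TensorProduct.lid ℂ H (LinearMap.rTensor H (Coalgebra.counit (R := ℂ)) u)) * g) := by
  induction u with
  | zero => simp
  | add x y hx hy => simp only [map_add, hx, hy, add_mul, smul_add]
  | tmul a b =>
    have h1 := LinearMap.congr_fun he (c ⊗ₜ[ℂ] a)
    simp only [LinearMap.comp_apply, TensorProduct.map_tmul, LinearMap.mul'_apply] at h1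
    simp [h1, mul_smul]

/-!
STATEMENT 9: In the Hopf–Galois coextension setting, for all `c ∈ C` and
`h, g ∈ H`, the element `c⁽¹⁾·h ⊗ c⁽²⁾·g` lies in `C □_D C`, and
`κ (c⁽¹⁾·h ⊗ c⁽²⁾·g) = ε(c) • (S(h) * g)`.
-/
theorem kappa_on_diagonal {C D H : Type*} [Ring H] [HopfAlgebra ℂ H]
    [AddCommGroup C] [Module ℂ C] [Coalgebra ℂ C]
    [AddCommGroup D] [Module ℂ D] [Coalgebra ℂ D]
    (act : C ⊗[ℂ] H →ₗ[ℂ] C) (π : C →ₗ[ℂ] D)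
    (βinv : C ⊗[ℂ] C →ₗ[ℂ] C ⊗[ℂ] H)
    (hgal : IsGaloisCoextension C D H act π βinv) (c : C) (h g : H) :
    TensorProduct.map act act
        ((TensorProduct.tensorTensorTensorComm ℂ C C H H)
          ((Coalgebra.comul (R := ℂ) c) ⊗ₜ[ℂ] (h ⊗ₜ[ℂ] g))) ∈ cot C D π ∧
    κ C H βinv
        (TensorProduct.map act act
          ((TensorProduct.tensorTensorTensorComm ℂ C C H H)
            ((Coalgebra.comul (R := ℂ) c) ⊗ₜ[ℂ] (h ⊗ₜ[ℂ] g))))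
      = (Coalgebra.counit (R := ℂ) c) • (HopfAlgebra.antipode (R := ℂ) h * g) := by
  have key := aux_beta act hgal.act_mul hgal.comul_act c g (Coalgebra.comul (R := ℂ) h)
  rw [aux_hopf] at key
  rw [← key]
  refine ⟨hgal.β_mem_cot _, ?_⟩
  simp only [κ, LinearMap.comp_apply, hgal.βinv_β, LinearEquiv.coe_coe]
  rw [aux_eps act hgal.counit_act, Coalgebra.rTensor_counit_comul]
  simp

end Gal
end
end

section
/- In the Hopf–Galois coextension setting, for every x = Σ c⊗c' ∈ C□_D C and every h ∈ H, the element Σ c·h ⊗ c' lies in C□_D C and κ(Σ c·h ⊗ c') = S(h)·κ(x). -/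
open TensorProduct

noncomputable section

namespace Gal

variable (C D H : Type*) [Ring H] [HopfAlgebra ℂ H]
  [AddCommGroup C] [Module ℂ C] [Coalgebra ℂ C]
  [AddCommGroup D] [Module ℂ D] [Coalgebra ℂ D]

section aux
variable {C D H : Type*} [Ring H] [HopfAlgebra ℂ H]
    [AddCommGroup C] [Module ℂ C] [Coalgebra ℂ C]
    [AddCommGroup D] [Module ℂ D] [Coalgebra ℂ D]

/-- `p ⊗ q ↦ c·p ⊗ S(q) k`. -/
def auxG (act : C ⊗[ℂ] H →ₗ[ℂ] C) (c : C) (k : H) : H ⊗[ℂ] H →ₗ[ℂ] C ⊗[ℂ] H :=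
  TensorProduct.map (act ∘ₗ TensorProduct.mk ℂ C H c)
    (LinearMap.mulRight ℂ k ∘ₗ HopfAlgebra.antipode ℂ)

/-- `(p ⊗ q) ⊗ r ↦ z₁·p ⊗ (z₂·q)·(S(r) k)`. -/
def auxF (act : C ⊗[ℂ] H →ₗ[ℂ] C) (k : H) (z : C ⊗[ℂ] C) :
    (H ⊗[ℂ] H) ⊗[ℂ] H →ₗ[ℂ] C ⊗[ℂ] C :=
  LinearMap.lTensor C act ∘ₗ (TensorProduct.assoc ℂ C C H).toLinearMap ∘ₗ
    TensorProduct.map (TensorProduct.map act act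
        ∘ₗ (TensorProduct.tensorTensorTensorComm ℂ C C H H).toLinearMap
        ∘ₗ TensorProduct.mk ℂ (C ⊗[ℂ] C) (H ⊗[ℂ] H) z)
      (LinearMap.mulRight ℂ k ∘ₗ HopfAlgebra.antipode ℂ)

theorem auxF_add (act : C ⊗[ℂ] H →ₗ[ℂ] C) (k : H) (z z' : C ⊗[ℂ] C) :
    auxF act k (z + z') = auxF act k z + auxF act k z' := by
  simp [auxF, LinearMap.comp_add, TensorProduct.map_add_left]

theorem auxF_zero (act : C ⊗[ℂ] H →ₗ[ℂ] C) (k : H) :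
    auxF act k (0 : C ⊗[ℂ] C) = 0 := by
  simp [auxF]

theorem β_auxG {act : C ⊗[ℂ] H →ₗ[ℂ] C} {π : C →ₗ[ℂ] D} {βinv : C ⊗[ℂ] C →ₗ[ℂ] C ⊗[ℂ] H}
    (hgal : IsGaloisCoextension C D H act π βinv) (c : C) (k : H) :
    βcan C H act ∘ₗ auxG act c k
      = auxF act k (Coalgebra.comul (R := ℂ) c) ∘ₗ
        LinearMap.rTensor H (Coalgebra.comul (R := ℂ)) := by
  ext p q
  have h := LinearMap.congr_fun hgal.comul_act (c ⊗ₜ[ℂ] p)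
  simp only [LinearMap.comp_apply, LinearEquiv.coe_coe, TensorProduct.map_tmul] at h
  simp [βcan, auxG, auxF, h]

theorem auxF_tmul {act : C ⊗[ℂ] H →ₗ[ℂ] C} {π : C →ₗ[ℂ] D} {βinv : C ⊗[ℂ] C →ₗ[ℂ] C ⊗[ℂ] H}
    (hgal : IsGaloisCoextension C D H act π βinv) (a b : C) (k : H) :
    auxF act k (a ⊗ₜ[ℂ] b) ∘ₗ (TensorProduct.assoc ℂ H H H).symm.toLinearMap
      = TensorProduct.map (act ∘ₗ TensorProduct.mk ℂ C H a)
          (act ∘ₗ TensorProduct.mk ℂ C H b ∘ₗ LinearMap.mulRight ℂ k) ∘ₗ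
        LinearMap.lTensor H (LinearMap.mul' ℂ H ∘ₗ
          LinearMap.lTensor H (HopfAlgebra.antipode ℂ)) := by
  ext p q r
  simp [auxF, hgal.act_mul, mul_assoc]

theorem auxF_comul {act : C ⊗[ℂ] H →ₗ[ℂ] C} {π : C →ₗ[ℂ] D} {βinv : C ⊗[ℂ] C →ₗ[ℂ] C ⊗[ℂ] H}
    (hgal : IsGaloisCoextension C D H act π βinv) (z : C ⊗[ℂ] C) (k h : H) :
    auxF act k z (LinearMap.rTensor H (Coalgebra.comul (R := ℂ)) (Coalgebra.comul (R := ℂ) h))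
      = TensorProduct.map (act ∘ₗ (TensorProduct.mk ℂ C H).flip h)
          (act ∘ₗ (TensorProduct.mk ℂ C H).flip k) z := by
  induction z using TensorProduct.induction_on with
  | zero => simp [auxF_zero]
  | add x y hx hy => rw [auxF_add, LinearMap.add_apply, hx, hy, map_add]
  | tmul a b =>
    have h1 := LinearMap.congr_fun (auxF_tmul hgal a b k)
      (LinearMap.lTensor H (Coalgebra.comul (R := ℂ)) (Coalgebra.comul (R := ℂ) h))
    simp only [LinearMap.comp_apply, LinearEquiv.coe_coe, Coalgebra.coassoc_symm_apply] at h1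
    rw [h1, ← LinearMap.comp_apply (LinearMap.lTensor H _) (LinearMap.lTensor H _),
      ← LinearMap.lTensor_comp, LinearMap.comp_assoc, HopfAlgebra.mul_antipode_lTensor_comul,
      LinearMap.lTensor_comp, LinearMap.comp_apply, Coalgebra.lTensor_counit_comul]
    simp

theorem main_tmul {act : C ⊗[ℂ] H →ₗ[ℂ] C} {π : C →ₗ[ℂ] D} {βinv : C ⊗[ℂ] C →ₗ[ℂ] C ⊗[ℂ] H}
    (hgal : IsGaloisCoextension C D H act π βinv) (c : C) (k h : H) :
    βcan C H act (auxG act c k (Coalgebra.comul (R := ℂ) h))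
      = LinearMap.rTensor C (act ∘ₗ (TensorProduct.mk ℂ C H).flip h)
          (βcan C H act (c ⊗ₜ[ℂ] k)) := by
  have h1 := LinearMap.congr_fun (β_auxG hgal c k) (Coalgebra.comul (R := ℂ) h)
  simp only [LinearMap.comp_apply] at h1
  rw [h1, auxF_comul hgal]
  simp only [βcan, LinearMap.comp_apply, LinearEquiv.coe_coe, LinearMap.rTensor_tmul]
  generalize (Coalgebra.comul (R := ℂ) c : C ⊗[ℂ] C) = z
  induction z using TensorProduct.induction_on with
  | zero => simp
  | add x y hx hy => simp only [map_add, TensorProduct.add_tmul, hx, hy]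
  | tmul a b => simp

theorem counit_auxG {act : C ⊗[ℂ] H →ₗ[ℂ] C} {π : C →ₗ[ℂ] D}
    {βinv : C ⊗[ℂ] C →ₗ[ℂ] C ⊗[ℂ] H}
    (hgal : IsGaloisCoextension C D H act π βinv) (c : C) (k h : H) :
    TensorProduct.lid ℂ H (LinearMap.rTensor H (Coalgebra.counit (R := ℂ))
      (auxG act c k (Coalgebra.comul (R := ℂ) h)))
      = HopfAlgebra.antipode ℂ h * (Coalgebra.counit (R := ℂ) c • k) := by
  have h1 : (TensorProduct.lid ℂ H).toLinearMap ∘ₗ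
      LinearMap.rTensor H (Coalgebra.counit (R := ℂ)) ∘ₗ auxG act c k
      = (Coalgebra.counit (R := ℂ) c • (LinearMap.mulRight ℂ k ∘ₗ HopfAlgebra.antipode ℂ)) ∘ₗ
        (TensorProduct.lid ℂ H).toLinearMap ∘ₗ
          LinearMap.rTensor H (Coalgebra.counit (R := ℂ)) := by
    ext p q
    have h := LinearMap.congr_fun hgal.counit_act (c ⊗ₜ[ℂ] p)
    simp only [LinearMap.comp_apply, TensorProduct.map_tmul, LinearMap.mul'_apply] at h
    simp [auxG, h, mul_smul]
  have h2 := LinearMap.congr_fun h1 (Coalgebra.comul (R := ℂ) h)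
  simp only [LinearMap.comp_apply, LinearEquiv.coe_coe, Coalgebra.rTensor_counit_comul] at h2
  rw [h2]
  simp

end aux

/-!
STATEMENT 10: In the Hopf–Galois coextension setting, for every
`x = Σ c ⊗ c' ∈ C □_D C` and every `h ∈ H`, the element `Σ c·h ⊗ c'` lies in
`C □_D C` and `κ (Σ c·h ⊗ c') = S(h) * κ(x)`.
-/
theorem kappa_act_left {C D H : Type*} [Ring H] [HopfAlgebra ℂ H]
    [AddCommGroup C] [Module ℂ C] [Coalgebra ℂ C]
    [AddCommGroup D] [Module ℂ D] [Coalgebra ℂ D]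
    (act : C ⊗[ℂ] H →ₗ[ℂ] C) (π : C →ₗ[ℂ] D)
    (βinv : C ⊗[ℂ] C →ₗ[ℂ] C ⊗[ℂ] H)
    (hgal : IsGaloisCoextension C D H act π βinv) :
    ∀ x ∈ cot C D π, ∀ h : H,
      LinearMap.rTensor C (act ∘ₗ (TensorProduct.mk ℂ C H).flip h) x ∈ cot C D π ∧
      κ C H βinv (LinearMap.rTensor C (act ∘ₗ (TensorProduct.mk ℂ C H).flip h) x)
        = HopfAlgebra.antipode (R := ℂ) h * κ C H βinv x := by
  intro x hx h
  obtain ⟨y, rfl⟩ : ∃ y, βcan C H act y = x := ⟨_, hgal.β_βinv x hx⟩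
  clear hx
  induction y using TensorProduct.induction_on with
  | zero => simp
  | add y z hy hz =>
    simp only [map_add, mul_add]
    exact ⟨Submodule.add_mem _ hy.1 hz.1, by rw [hy.2, hz.2]⟩
  | tmul c k =>
    rw [← main_tmul hgal]
    refine ⟨hgal.β_mem_cot _, ?_⟩
    simp only [κ, LinearMap.comp_apply, LinearEquiv.coe_coe, hgal.βinv_β]
    rw [counit_auxG hgal]
    simp

end Gal
end
end

section
/- In the Hopf–Galois coextension setting, the subspace C^D is closed under the right H-action: if c ∈ C^D and h ∈ H then c·h ∈ C^D. -/
open TensorProduct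

noncomputable section

namespace Gal

variable (C D H : Type*) [Ring H] [HopfAlgebra ℂ H]
  [AddCommGroup C] [Module ℂ C] [Coalgebra ℂ C]
  [AddCommGroup D] [Module ℂ D] [Coalgebra ℂ D]

/-- `C^D = {c ∈ C : c⁽¹⁾ ⊗ π(c⁽²⁾) = c⁽²⁾ ⊗ π(c⁽¹⁾)}`. -/
def CD (π : C →ₗ[ℂ] D) : Submodule ℂ C :=
  LinearMap.eqLocus
    (LinearMap.lTensor C π ∘ₗ Coalgebra.comul (R := ℂ))
    (LinearMap.lTensor C π ∘ₗ (TensorProduct.comm ℂ C C).toLinearMap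
      ∘ₗ Coalgebra.comul (R := ℂ))

/-!
STATEMENT 13: In the Hopf–Galois coextension setting, `C^D` is closed under
the right `H`-action: if `c ∈ C^D` and `h ∈ H` then `c·h ∈ C^D`.
-/
theorem CD_act_closed {C D H : Type*} [Ring H] [HopfAlgebra ℂ H]
    [AddCommGroup C] [Module ℂ C] [Coalgebra ℂ C]
    [AddCommGroup D] [Module ℂ D] [Coalgebra ℂ D]
    (act : C ⊗[ℂ] H →ₗ[ℂ] C) (π : C →ₗ[ℂ] D)
    (βinv : C ⊗[ℂ] C →ₗ[ℂ] C ⊗[ℂ] H)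
    (hgal : IsGaloisCoextension C D H act π βinv) :
    ∀ c ∈ CD C D π, ∀ h : H, act (c ⊗ₜ[ℂ] h) ∈ CD C D π := by
  intro c hc h
  have hπ : ∀ (c : C) (h : H), π (act (c ⊗ₜ[ℂ] h)) = Coalgebra.counit (R := ℂ) h • π c := by
    intro c h
    have : act (c ⊗ₜ[ℂ] h) - (Coalgebra.counit (R := ℂ) h) • c ∈ LinearMap.ker π := by
      rw [hgal.ker_π]
      exact Submodule.subset_span ⟨c, h, rfl⟩
    rw [LinearMap.mem_ker, map_sub, map_smul, sub_eq_zero] at this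
    exact this
  let A : H →ₗ[ℂ] C →ₗ[ℂ] C := (TensorProduct.mk ℂ C H).flip.compr₂ act
  have hA : ∀ (a : H) (x : C), A a x = act (x ⊗ₜ[ℂ] a) := fun a x => rfl
  have key1 : ∀ (y : H ⊗[ℂ] H) (x : C ⊗[ℂ] C),
      LinearMap.lTensor C π (TensorProduct.map act act
        (TensorProduct.tensorTensorTensorComm ℂ C C H H (x ⊗ₜ[ℂ] y)))
      = LinearMap.rTensor D (A (TensorProduct.rid ℂ H
          (LinearMap.lTensor H (Coalgebra.counit (R := ℂ)) y))) (LinearMap.lTensor C π x) := by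
    intro y x
    induction y using TensorProduct.induction_on with
    | zero => simp
    | add y z hy hz =>
      rw [TensorProduct.tmul_add]
      simp only [map_add, hy, hz, LinearMap.rTensor_add, LinearMap.add_apply]
    | tmul a b =>
      induction x using TensorProduct.induction_on with
      | zero => simp
      | add y z hy hz =>
        rw [TensorProduct.add_tmul]
        simp only [map_add, hy, hz]
      | tmul u v =>
        simp [hπ, hA, LinearMap.rTensor_smul, TensorProduct.tmul_smul]
  have key2 : ∀ (y : H ⊗[ℂ] H) (x : C ⊗[ℂ] C),
      LinearMap.lTensor C π (TensorProduct.comm ℂ C C (TensorProduct.map act act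
        (TensorProduct.tensorTensorTensorComm ℂ C C H H (x ⊗ₜ[ℂ] y))))
      = LinearMap.rTensor D (A (TensorProduct.lid ℂ H
          (LinearMap.rTensor H (Coalgebra.counit (R := ℂ)) y)))
          (LinearMap.lTensor C π (TensorProduct.comm ℂ C C x)) := by
    intro y x
    induction y using TensorProduct.induction_on with
    | zero => simp
    | add y z hy hz =>
      rw [TensorProduct.tmul_add]
      simp only [map_add, hy, hz, LinearMap.rTensor_add, LinearMap.add_apply]
    | tmul a b =>
      induction x using TensorProduct.induction_on with
      | zero => simp
      | add y z hy hz =>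
        rw [TensorProduct.add_tmul]
        simp only [map_add, hy, hz]
      | tmul u v =>
        simp [hπ, hA, LinearMap.rTensor_smul, TensorProduct.tmul_smul]
  have hcomul : Coalgebra.comul (R := ℂ) (act (c ⊗ₜ[ℂ] h)) = TensorProduct.map act act
        (TensorProduct.tensorTensorTensorComm ℂ C C H H
          (Coalgebra.comul (R := ℂ) c ⊗ₜ[ℂ] Coalgebra.comul (R := ℂ) h)) :=
    LinearMap.congr_fun hgal.comul_act (c ⊗ₜ[ℂ] h)
  have hc' : LinearMap.lTensor C π (Coalgebra.comul (R := ℂ) c)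
      = LinearMap.lTensor C π (TensorProduct.comm ℂ C C (Coalgebra.comul (R := ℂ) c)) := hc
  change LinearMap.lTensor C π (Coalgebra.comul (R := ℂ) (act (c ⊗ₜ[ℂ] h)))
    = LinearMap.lTensor C π (TensorProduct.comm ℂ C C (Coalgebra.comul (R := ℂ) (act (c ⊗ₜ[ℂ] h))))
  rw [hcomul, key1, key2, hc', Coalgebra.lTensor_counit_comul, Coalgebra.rTensor_counit_comul]
  simp

end Gal
end
end

section
/- In the Hopf–Galois coextension setting, the canonical map β maps C^D ⊗ H into (C□_D C)^D, and its restriction β̄ : C^D ⊗ H → (C□_D C)^D is a linear bijection. -/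
open TensorProduct

noncomputable section

namespace Gal

variable (C D H : Type*) [Ring H] [HopfAlgebra ℂ H]
  [AddCommGroup C] [Module ℂ C] [Coalgebra ℂ C]
  [AddCommGroup D] [Module ℂ D] [Coalgebra ℂ D]

/-- `c ⊗ c' ↦ c ⊗ (c'⁽¹⁾ ⊗ π(c'⁽²⁾))`. -/
def coinvL (π : C →ₗ[ℂ] D) : C ⊗[ℂ] C →ₗ[ℂ] C ⊗[ℂ] (C ⊗[ℂ] D) :=
  LinearMap.lTensor C (LinearMap.lTensor C π ∘ₗ Coalgebra.comul (R := ℂ))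

/-- `c ⊗ c' ↦ c⁽²⁾ ⊗ (c' ⊗ π(c⁽¹⁾))`. -/
def coinvR (π : C →ₗ[ℂ] D) : C ⊗[ℂ] C →ₗ[ℂ] C ⊗[ℂ] (C ⊗[ℂ] D) :=
  LinearMap.lTensor C (LinearMap.lTensor C π)
    ∘ₗ LinearMap.lTensor C (TensorProduct.comm ℂ C C).toLinearMap
    ∘ₗ (TensorProduct.assoc ℂ C C C).toLinearMap
    ∘ₗ LinearMap.rTensor C (TensorProduct.comm ℂ C C).toLinearMap
    ∘ₗ LinearMap.rTensor C (Coalgebra.comul (R := ℂ))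

/-- `(C □_D C)^D` as a subspace of `C ⊗ C`. -/
def cotD (π : C →ₗ[ℂ] D) : Submodule ℂ (C ⊗[ℂ] C) :=
  cot C D π ⊓ LinearMap.eqLocus (coinvL C D π) (coinvR C D π)

section helpers
variable {C D H}

/-- Right action by a fixed `h`. -/
def actH (act : C ⊗[ℂ] H →ₗ[ℂ] C) (h : H) : C →ₗ[ℂ] C :=
  act ∘ₗ (TensorProduct.mk ℂ C H).flip h

theorem actH_apply (act : C ⊗[ℂ] H →ₗ[ℂ] C) (h : H) (c : C) :
    actH act h c = act (c ⊗ₜ h) := rfl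

/-- `β ⊗ id_D` up to rearrangement. -/
def Phi (act : C ⊗[ℂ] H →ₗ[ℂ] C) : (C ⊗[ℂ] D) ⊗[ℂ] H →ₗ[ℂ] C ⊗[ℂ] (C ⊗[ℂ] D) :=
  (TensorProduct.assoc ℂ C C D).toLinearMap ∘ₗ LinearMap.rTensor D (βcan C H act)
    ∘ₗ (TensorProduct.rightComm ℂ C D H).toLinearMap

theorem βcan_tmul (act : C ⊗[ℂ] H →ₗ[ℂ] C) (c : C) (h : H) :
    βcan C H act (c ⊗ₜ h) = LinearMap.lTensor C (actH act h) (Coalgebra.comul (R := ℂ) c) := by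
  simp only [βcan, LinearMap.comp_apply, LinearMap.rTensor_tmul, LinearEquiv.coe_coe]
  induction Coalgebra.comul (R := ℂ) c using TensorProduct.induction_on with
  | zero => simp
  | tmul a b => simp [actH_apply]
  | add x y hx hy => simp only [TensorProduct.add_tmul, map_add, hx, hy]

theorem π_act {act : C ⊗[ℂ] H →ₗ[ℂ] C} {π : C →ₗ[ℂ] D}
    {βinv : C ⊗[ℂ] C →ₗ[ℂ] C ⊗[ℂ] H}
    (hg : IsGaloisCoextension C D H act π βinv) (c : C) (h : H) :
    π (act (c ⊗ₜ h)) = Coalgebra.counit (R := ℂ) h • π c := by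
  have : act (c ⊗ₜ[ℂ] h) - (Coalgebra.counit (R := ℂ) h) • c ∈ LinearMap.ker π := by
    rw [hg.ker_π]; exact Submodule.subset_span ⟨c, h, rfl⟩
  rw [LinearMap.mem_ker, map_sub, map_smul, sub_eq_zero] at this
  exact this

theorem comul_actH {act : C ⊗[ℂ] H →ₗ[ℂ] C} {π : C →ₗ[ℂ] D}
    {βinv : C ⊗[ℂ] C →ₗ[ℂ] C ⊗[ℂ] H}
    (hg : IsGaloisCoextension C D H act π βinv) (c : C) (h : H) :
    LinearMap.lTensor C π (Coalgebra.comul (R := ℂ) (actH act h c))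
      = TensorProduct.map (actH act h) π (Coalgebra.comul (R := ℂ) c) := by
  have h1 := LinearMap.congr_fun hg.comul_act (c ⊗ₜ h)
  simp only [LinearMap.comp_apply, LinearEquiv.coe_coe, TensorProduct.map_tmul] at h1
  rw [actH_apply, h1]
  have h2 : h = TensorProduct.rid ℂ H (LinearMap.lTensor H (Coalgebra.counit (R := ℂ))
      (Coalgebra.comul (R := ℂ) h)) := by simp
  conv_rhs => rw [h2]
  induction Coalgebra.comul (R := ℂ) c using TensorProduct.induction_on with
  | zero => simp
  | add x y hx hy => simp only [TensorProduct.add_tmul, map_add, hx, hy]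
  | tmul a b =>
    induction Coalgebra.comul (R := ℂ) h using TensorProduct.induction_on with
    | zero => simp [actH_apply]
    | add x y hx hy =>
      simp only [TensorProduct.map_tmul, actH_apply] at hx hy ⊢
      simp only [TensorProduct.tmul_add, map_add, hx, hy, TensorProduct.add_tmul]
    | tmul k l =>
      simp [actH_apply, π_act hg, TensorProduct.tmul_smul, TensorProduct.smul_tmul]

theorem Phi_tmul (act : C ⊗[ℂ] H →ₗ[ℂ] C) (c : C) (d : D) (h : H) :
    Phi act ((c ⊗ₜ[ℂ] d) ⊗ₜ[ℂ] h) = TensorProduct.assoc ℂ C C D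
      (LinearMap.lTensor C (actH act h) (Coalgebra.comul (R := ℂ) c) ⊗ₜ d) := by
  simp [Phi, βcan_tmul]

theorem coinvL_β {act : C ⊗[ℂ] H →ₗ[ℂ] C} {π : C →ₗ[ℂ] D}
    {βinv : C ⊗[ℂ] C →ₗ[ℂ] C ⊗[ℂ] H}
    (hg : IsGaloisCoextension C D H act π βinv) :
    coinvL C D π ∘ₗ βcan C H act
      = Phi act ∘ₗ LinearMap.rTensor H (LinearMap.lTensor C π ∘ₗ Coalgebra.comul (R := ℂ)) := by
  ext c h
  have key := congrArg (LinearMap.lTensor C (TensorProduct.map (actH act h) π))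
    (Coalgebra.coassoc_apply (R := ℂ) c)
  have e1 : ∀ z : C ⊗[ℂ] C, coinvL C D π (LinearMap.lTensor C (actH act h) z) =
      LinearMap.lTensor C (TensorProduct.map (actH act h) π)
        (LinearMap.lTensor C (Coalgebra.comul (R := ℂ)) z) := by
    intro z
    induction z using TensorProduct.induction_on with
    | zero => simp
    | add x y hx hy => simp only [map_add, hx, hy]
    | tmul a b => simp [coinvL, comul_actH hg]
  have e2 : ∀ z : C ⊗[ℂ] C, Phi act (LinearMap.lTensor C π z ⊗ₜ[ℂ] h) =
      LinearMap.lTensor C (TensorProduct.map (actH act h) π)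
        (TensorProduct.assoc ℂ C C C (LinearMap.rTensor C (Coalgebra.comul (R := ℂ)) z)) := by
    intro z
    induction z using TensorProduct.induction_on with
    | zero => simp
    | add x y hx hy => simp only [map_add, TensorProduct.add_tmul, hx, hy]
    | tmul a b =>
      simp only [LinearMap.lTensor_tmul, LinearMap.rTensor_tmul, Phi_tmul]
      induction Coalgebra.comul (R := ℂ) a using TensorProduct.induction_on with
      | zero => simp
      | add x y hx hy => simp only [map_add, TensorProduct.add_tmul, hx, hy]
      | tmul p q => simp
  simp only [TensorProduct.AlgebraTensorModule.curry_apply, TensorProduct.curry_apply,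
    LinearMap.coe_restrictScalars, LinearMap.comp_apply, LinearMap.rTensor_tmul, βcan_tmul]
  rw [e1, e2, key]

theorem coinvR_β (act : C ⊗[ℂ] H →ₗ[ℂ] C) (π : C →ₗ[ℂ] D) :
    coinvR C D π ∘ₗ βcan C H act
      = Phi act ∘ₗ LinearMap.rTensor H (LinearMap.lTensor C π
        ∘ₗ (TensorProduct.comm ℂ C C).toLinearMap ∘ₗ Coalgebra.comul (R := ℂ)) := by
  ext c h
  let T : C ⊗[ℂ] (C ⊗[ℂ] C) →ₗ[ℂ] C ⊗[ℂ] (C ⊗[ℂ] D) :=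
    (TensorProduct.assoc ℂ C C D).toLinearMap
      ∘ₗ TensorProduct.map (LinearMap.lTensor C (actH act h)) π
      ∘ₗ (TensorProduct.comm ℂ C (C ⊗[ℂ] C)).toLinearMap
  have key := congrArg T (Coalgebra.coassoc_apply (R := ℂ) c)
  have e1 : ∀ z : C ⊗[ℂ] C, coinvR C D π (LinearMap.lTensor C (actH act h) z) =
      T (TensorProduct.assoc ℂ C C C (LinearMap.rTensor C (Coalgebra.comul (R := ℂ)) z)) := by
    intro z
    induction z using TensorProduct.induction_on with
    | zero => simp
    | add x y hx hy => simp only [map_add, hx, hy]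
    | tmul a b =>
      simp only [coinvR, LinearMap.comp_apply, LinearMap.lTensor_tmul, LinearMap.rTensor_tmul]
      induction Coalgebra.comul (R := ℂ) a using TensorProduct.induction_on with
      | zero => simp
      | add x y hx hy => simp only [map_add, TensorProduct.add_tmul, hx, hy]
      | tmul p q => simp [T]
  have e2 : ∀ z : C ⊗[ℂ] C,
      Phi act (LinearMap.lTensor C π (TensorProduct.comm ℂ C C z) ⊗ₜ[ℂ] h) =
      T (LinearMap.lTensor C (Coalgebra.comul (R := ℂ)) z) := by
    intro z
    induction z using TensorProduct.induction_on with
    | zero => simp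
    | add x y hx hy => simp only [map_add, TensorProduct.add_tmul, hx, hy]
    | tmul a b => simp [T, Phi_tmul]
  simp only [TensorProduct.AlgebraTensorModule.curry_apply, TensorProduct.curry_apply,
    LinearMap.coe_restrictScalars, LinearMap.comp_apply, LinearMap.rTensor_tmul, βcan_tmul,
    LinearEquiv.coe_coe]
  rw [e1, e2, key]

theorem Phi_injective {act : C ⊗[ℂ] H →ₗ[ℂ] C}
    (hi : Function.Injective (βcan C H act)) :
    Function.Injective (Phi (D := D) act) := by
  have := Module.Flat.rTensor_preserves_injective_linearMap (M := D) _ hi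
  simpa [Phi] using this

theorem range_eqLocus {V W : Type*} [AddCommGroup V] [Module ℂ V] [AddCommGroup W] [Module ℂ W]
    (f g : V →ₗ[ℂ] W) (x : V ⊗[ℂ] H) :
    x ∈ LinearMap.range (LinearMap.rTensor H (LinearMap.eqLocus f g).subtype)
      ↔ LinearMap.rTensor H f x = LinearMap.rTensor H g x := by
  have hex : Function.Exact (LinearMap.eqLocus f g).subtype (f - g) := by
    intro y
    simp [sub_eq_zero]
  have := Module.Flat.rTensor_exact H hex x
  rw [LinearMap.mem_range, ← Set.mem_range, ← this, LinearMap.rTensor_sub, LinearMap.sub_apply,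
    sub_eq_zero]

end helpers

/-!
STATEMENT 14: In the Hopf–Galois coextension setting, the canonical map `β`
maps `C^D ⊗ H` into `(C □_D C)^D` and restricts to a linear bijection
`C^D ⊗ H → (C □_D C)^D`.
-/
theorem can_bijOn {C D H : Type*} [Ring H] [HopfAlgebra ℂ H]
    [AddCommGroup C] [Module ℂ C] [Coalgebra ℂ C]
    [AddCommGroup D] [Module ℂ D] [Coalgebra ℂ D]
    (act : C ⊗[ℂ] H →ₗ[ℂ] C) (π : C →ₗ[ℂ] D)
    (βinv : C ⊗[ℂ] C →ₗ[ℂ] C ⊗[ℂ] H)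
    (hgal : IsGaloisCoextension C D H act π βinv) :
    Set.BijOn (βcan C H act)
      (LinearMap.range (LinearMap.rTensor H (CD C D π).subtype) : Set (C ⊗[ℂ] H))
      (cotD C D π : Set (C ⊗[ℂ] C)) := by
  have hi : Function.Injective (βcan C H act) :=
    Function.LeftInverse.injective hgal.βinv_β
  have key : ∀ x : C ⊗[ℂ] H,
      βcan C H act x ∈ LinearMap.eqLocus (coinvL C D π) (coinvR C D π) ↔
      x ∈ LinearMap.range (LinearMap.rTensor H (CD C D π).subtype) := by
    intro x
    have hL := LinearMap.congr_fun (coinvL_β hgal) x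
    have hR := LinearMap.congr_fun (coinvR_β act π) x
    simp only [LinearMap.comp_apply] at hL hR
    rw [CD, range_eqLocus, LinearMap.mem_eqLocus, hL, hR]
    exact (Phi_injective hi).eq_iff
  refine ⟨fun x hx => ⟨hgal.β_mem_cot x, (key x).2 hx⟩, hi.injOn, fun y hy => ?_⟩
  have hb := hgal.β_βinv y hy.1
  refine ⟨βinv y, (key _).1 ?_, hb⟩
  rw [hb]; exact hy.2

end Gal
end
end

section
/- Let H be a Hopf algebra over ℂ, C a right H-comodule coalgebra, and M a right-left stable anti-Yetter–Drinfeld module over H. For each n ≥ 0, the operator τ_n on C^{⊗(n+1)}⊗M defined by τ_n(c₀⊗c₁⊗…⊗c_n⊗m) = c₁⊗…⊗c_n⊗(c₀)₍₀₎ ⊗ m·(c₀)₍₁₎ maps the cotensor product C^{⊗(n+1)}□_H M into itself. -/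
/-!
STATEMENT 17: Let `H` be a Hopf algebra over `ℂ`, `C` a right `H`-comodule
coalgebra, and `M` a right-left stable anti-Yetter–Drinfeld module over `H`.
For each `n ≥ 0`, the operator
`τ_n (c₀ ⊗ … ⊗ c_n ⊗ m) = c₁ ⊗ … ⊗ c_n ⊗ (c₀)₍₀₎ ⊗ m · (c₀)₍₁₎`
maps the cotensor product `C^{⊗(n+1)} □_H M` into itself.
-/

open TensorProduct

noncomputable section

namespace Stmt17

variable (C H M : Type) [Ring H] [HopfAlgebra ℂ H]
  [AddCommGroup C] [Module ℂ C] [Coalgebra ℂ C]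
  [AddCommGroup M] [Module ℂ M]

/-- `Θ (h) = h⁽¹⁾ ⊗ (h⁽²⁾ ⊗ S(h⁽³⁾))`. -/
def Θ : H →ₗ[ℂ] H ⊗[ℂ] (H ⊗[ℂ] H) :=
  LinearMap.lTensor H (LinearMap.lTensor H (HopfAlgebra.antipode (R := ℂ)))
    ∘ₗ (TensorProduct.assoc ℂ H H H).toLinearMap
    ∘ₗ LinearMap.rTensor H (Coalgebra.comul (R := ℂ))
    ∘ₗ Coalgebra.comul (R := ℂ)

/-- `(k ⊗ m) ⊗ h ↦ S(h⁽³⁾) k h⁽¹⁾ ⊗ m · h⁽²⁾` (the right-hand side of the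
anti-Yetter–Drinfeld condition). -/
def aydM (actM : M ⊗[ℂ] H →ₗ[ℂ] M) : (H ⊗[ℂ] M) ⊗[ℂ] H →ₗ[ℂ] H ⊗[ℂ] M :=
  LinearMap.rTensor M (LinearMap.mul' ℂ H)
    ∘ₗ (TensorProduct.assoc ℂ H H M).symm.toLinearMap
    ∘ₗ (TensorProduct.comm ℂ (H ⊗[ℂ] M) H).toLinearMap
    ∘ₗ (TensorProduct.assoc ℂ H M H).symm.toLinearMap
    ∘ₗ TensorProduct.map (LinearMap.mul' ℂ H)
        (LinearMap.rTensor H actM ∘ₗ (TensorProduct.assoc ℂ M H H).symm.toLinearMap)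
    ∘ₗ (TensorProduct.tensorTensorTensorComm ℂ H M H (H ⊗[ℂ] H)).toLinearMap
    ∘ₗ LinearMap.lTensor (H ⊗[ℂ] M) (Θ H)

/-- `C` is a right `H`-comodule coalgebra via the coaction `coaC`. -/
structure IsComoduleCoalgebra (coaC : C →ₗ[ℂ] C ⊗[ℂ] H) : Prop where
  coassoc : LinearMap.lTensor C (Coalgebra.comul (R := ℂ)) ∘ₗ coaC
    = (TensorProduct.assoc ℂ C H H).toLinearMap ∘ₗ LinearMap.rTensor H coaC ∘ₗ coaC
  counit : (TensorProduct.rid ℂ C).toLinearMap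
      ∘ₗ LinearMap.lTensor C (Coalgebra.counit (R := ℂ)) ∘ₗ coaC = LinearMap.id
  comul_compat : LinearMap.lTensor (C ⊗[ℂ] C) (LinearMap.mul' ℂ H)
      ∘ₗ (TensorProduct.tensorTensorTensorComm ℂ C H C H).toLinearMap
      ∘ₗ TensorProduct.map coaC coaC ∘ₗ Coalgebra.comul (R := ℂ)
    = LinearMap.rTensor H (Coalgebra.comul (R := ℂ)) ∘ₗ coaC
  counit_compat : (TensorProduct.lid ℂ H).toLinearMap
      ∘ₗ LinearMap.rTensor H (Coalgebra.counit (R := ℂ)) ∘ₗ coaC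
    = Algebra.linearMap ℂ H ∘ₗ Coalgebra.counit (R := ℂ)

/-- `M` is a right-left stable anti-Yetter–Drinfeld module over `H` via the
action `actM` and the coaction `coaM`. -/
structure IsSAYD (actM : M ⊗[ℂ] H →ₗ[ℂ] M) (coaM : M →ₗ[ℂ] H ⊗[ℂ] M) : Prop where
  act_one : ∀ m : M, actM (m ⊗ₜ[ℂ] 1) = m
  act_mul : ∀ (m : M) (h h' : H),
    actM (actM (m ⊗ₜ[ℂ] h) ⊗ₜ[ℂ] h') = actM (m ⊗ₜ[ℂ] (h * h'))
  coassoc : (TensorProduct.assoc ℂ H H M).toLinearMap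
      ∘ₗ LinearMap.rTensor M (Coalgebra.comul (R := ℂ)) ∘ₗ coaM
    = LinearMap.lTensor H coaM ∘ₗ coaM
  counit : (TensorProduct.lid ℂ M).toLinearMap
      ∘ₗ LinearMap.rTensor M (Coalgebra.counit (R := ℂ)) ∘ₗ coaM = LinearMap.id
  ayd : coaM ∘ₗ actM = aydM H M actM ∘ₗ LinearMap.rTensor H coaM
  stable : actM ∘ₗ (TensorProduct.comm ℂ H M).toLinearMap ∘ₗ coaM = LinearMap.id

/-- The iterated tensor power `Tpow n = C^{⊗(n+1)}`. -/
def Tpow : ℕ → ModuleCat ℂ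
  | 0 => ModuleCat.of ℂ C
  | (n + 1) => ModuleCat.of ℂ (C ⊗[ℂ] (Tpow n))

/-- Appending a factor at the right end: `Tpow n ⊗ C → Tpow (n+1)`. -/
def snoc : (n : ℕ) → (↥(Tpow C n) ⊗[ℂ] C →ₗ[ℂ] ↥(Tpow C (n + 1)))
  | 0 => LinearMap.id
  | (n + 1) =>
      (LinearMap.lTensor C (snoc n)
          ∘ₗ (TensorProduct.assoc ℂ C (↥(Tpow C n)) C).toLinearMap :
        (C ⊗[ℂ] ↥(Tpow C n)) ⊗[ℂ] C →ₗ[ℂ] C ⊗[ℂ] ↥(Tpow C (n + 1)))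

variable {C H}

/-- The diagonal right `H`-coaction on `Tpow n`:
`c₀ ⊗ … ⊗ c_n ↦ (c₀)₍₀₎ ⊗ … ⊗ (c_n)₍₀₎ ⊗ (c₀)₍₁₎ (c₁)₍₁₎ ⋯ (c_n)₍₁₎`. -/
def coaT (coaC : C →ₗ[ℂ] C ⊗[ℂ] H) :
    (n : ℕ) → (↥(Tpow C n) →ₗ[ℂ] ↥(Tpow C n) ⊗[ℂ] H)
  | 0 => coaC
  | (n + 1) =>
      (LinearMap.lTensor (C ⊗[ℂ] ↥(Tpow C n)) (LinearMap.mul' ℂ H)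
          ∘ₗ (TensorProduct.tensorTensorTensorComm ℂ C H (↥(Tpow C n)) H).toLinearMap
          ∘ₗ TensorProduct.map coaC (coaT coaC n) :
        C ⊗[ℂ] ↥(Tpow C n) →ₗ[ℂ] (C ⊗[ℂ] ↥(Tpow C n)) ⊗[ℂ] H)



/-- The cotensor product `C^{⊗(n+1)} □_H M` inside `Tpow n ⊗ M`. -/
def CotM (coaC : C →ₗ[ℂ] C ⊗[ℂ] H) (coaM : M →ₗ[ℂ] H ⊗[ℂ] M) (n : ℕ) :
    Submodule ℂ (↥(Tpow C n) ⊗[ℂ] M) :=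
  LinearMap.eqLocus
    ((TensorProduct.assoc ℂ (↥(Tpow C n)) H M).toLinearMap
      ∘ₗ LinearMap.rTensor M (coaT coaC n))
    (LinearMap.lTensor (↥(Tpow C n)) coaM)

/-- The cyclic operator
`τ_n (c₀ ⊗ … ⊗ c_n ⊗ m) = c₁ ⊗ … ⊗ c_n ⊗ (c₀)₍₀₎ ⊗ m · (c₀)₍₁₎`. -/
def tau (coaC : C →ₗ[ℂ] C ⊗[ℂ] H) (actM : M ⊗[ℂ] H →ₗ[ℂ] M) :
    (n : ℕ) → (↥(Tpow C n) ⊗[ℂ] M →ₗ[ℂ] ↥(Tpow C n) ⊗[ℂ] M)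
  | 0 =>
      (LinearMap.lTensor C (actM ∘ₗ (TensorProduct.comm ℂ H M).toLinearMap)
          ∘ₗ (TensorProduct.assoc ℂ C H M).toLinearMap
          ∘ₗ LinearMap.rTensor M coaC :
        C ⊗[ℂ] M →ₗ[ℂ] C ⊗[ℂ] M)
  | (n + 1) =>
      (TensorProduct.map (snoc C n) actM
          ∘ₗ TensorProduct.map (TensorProduct.comm ℂ C (↥(Tpow C n))).toLinearMap
              (TensorProduct.comm ℂ H M).toLinearMap
          ∘ₗ (TensorProduct.tensorTensorTensorComm ℂ C H (↥(Tpow C n)) M).toLinearMap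
          ∘ₗ (TensorProduct.assoc ℂ (C ⊗[ℂ] H) (↥(Tpow C n)) M).toLinearMap
          ∘ₗ LinearMap.rTensor M (LinearMap.rTensor (↥(Tpow C n)) coaC) :
        (C ⊗[ℂ] ↥(Tpow C n)) ⊗[ℂ] M →ₗ[ℂ] (C ⊗[ℂ] ↥(Tpow C n)) ⊗[ℂ] M)

section Helpers

variable {M}

def TT (actM : M ⊗[ℂ] H →ₗ[ℂ] M) (w : H) (m : M) : H ⊗[ℂ] H →ₗ[ℂ] H ⊗[ℂ] M :=
  LinearMap.rTensor M (LinearMap.mul' ℂ H)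
    ∘ₗ (TensorProduct.assoc ℂ H H M).symm.toLinearMap
    ∘ₗ LinearMap.lTensor H (TensorProduct.map (LinearMap.mulLeft ℂ w)
        (actM ∘ₗ TensorProduct.mk ℂ M H m) ∘ₗ Coalgebra.comul (R := ℂ))
    ∘ₗ (TensorProduct.comm ℂ H H).toLinearMap

def GG (actM : M ⊗[ℂ] H →ₗ[ℂ] M) (w : H) (m : M) : H ⊗[ℂ] H →ₗ[ℂ] H ⊗[ℂ] M :=
  aydM H M actM ∘ₗ (TensorProduct.comm ℂ H (H ⊗[ℂ] M)).toLinearMap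
    ∘ₗ LinearMap.lTensor H ((TensorProduct.mk ℂ H M).flip m ∘ₗ LinearMap.mulRight ℂ w)

def KK (actM : M ⊗[ℂ] H →ₗ[ℂ] M) (w : H) (m : M) : H ⊗[ℂ] H →ₗ[ℂ] H ⊗[ℂ] M :=
  TensorProduct.map (LinearMap.mulLeft ℂ w) (actM ∘ₗ TensorProduct.mk ℂ M H m)

theorem GG_eq (actM : M ⊗[ℂ] H →ₗ[ℂ] M) (w : H) (m : M) :
    GG actM w m = TT actM w m
      ∘ₗ LinearMap.lTensor H (LinearMap.mul' ℂ H
          ∘ₗ LinearMap.rTensor H (HopfAlgebra.antipode (R := ℂ)))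
      ∘ₗ (TensorProduct.assoc ℂ H H H).toLinearMap
      ∘ₗ LinearMap.rTensor H (Coalgebra.comul (R := ℂ)) := by
  apply TensorProduct.ext'
  intro h k
  simp only [GG, TT, aydM, Θ, LinearMap.comp_apply, LinearMap.lTensor_tmul,
    LinearMap.rTensor_tmul, LinearEquiv.coe_coe, TensorProduct.comm_tmul,
    LinearMap.flip_apply, TensorProduct.mk_apply, LinearMap.mulRight_apply]
  generalize Coalgebra.comul (R := ℂ) h = t
  induction t with
  | zero => simp
  | add x y hx hy => simp only [map_add, TensorProduct.tmul_add, TensorProduct.add_tmul, hx, hy]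
  | tmul a b =>
    simp only [LinearMap.comp_apply, LinearMap.lTensor_tmul,
      LinearMap.rTensor_tmul, LinearEquiv.coe_coe, TensorProduct.comm_tmul,
      TensorProduct.assoc_tmul, LinearMap.mul'_apply]
    generalize Coalgebra.comul (R := ℂ) a = s
    induction s with
    | zero => simp
    | add x y hx hy =>
      simp only [map_add, TensorProduct.tmul_add, TensorProduct.add_tmul, hx, hy]
    | tmul p q => simp [mul_assoc]

theorem GG_comul (actM : M ⊗[ℂ] H →ₗ[ℂ] M) (w : H) (m : M) :
    GG actM w m ∘ₗ Coalgebra.comul (R := ℂ) = KK actM w m ∘ₗ Coalgebra.comul (R := ℂ) := by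
  ext h
  rw [GG_eq]
  simp only [LinearMap.comp_apply, LinearEquiv.coe_coe, Coalgebra.coassoc_apply]
  rw [← LinearMap.comp_apply (LinearMap.lTensor H _), ← LinearMap.lTensor_comp,
    LinearMap.comp_assoc, HopfAlgebra.mul_antipode_rTensor_comul, LinearMap.lTensor_comp,
    LinearMap.comp_apply, Coalgebra.lTensor_counit_comul]
  simp only [TT, KK, LinearMap.comp_apply, LinearEquiv.coe_coe, LinearMap.lTensor_tmul,
    TensorProduct.comm_tmul, Algebra.linearMap_apply, map_one]
  generalize Coalgebra.comul (R := ℂ) h = t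
  induction t with
  | zero => simp
  | add x y hx hy => simp only [map_add, TensorProduct.tmul_add, hx, hy]
  | tmul a b => simp

/-- `c ⊗ (k ⊗ m) ↦ c₀ ⊗ ayd` -/
def Ph (coaC : C →ₗ[ℂ] C ⊗[ℂ] H) (actM : M ⊗[ℂ] H →ₗ[ℂ] M) :
    C ⊗[ℂ] (H ⊗[ℂ] M) →ₗ[ℂ] C ⊗[ℂ] (H ⊗[ℂ] M) :=
  LinearMap.lTensor C (aydM H M actM ∘ₗ (TensorProduct.comm ℂ H (H ⊗[ℂ] M)).toLinearMap)
    ∘ₗ (TensorProduct.assoc ℂ C H (H ⊗[ℂ] M)).toLinearMap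
    ∘ₗ LinearMap.rTensor (H ⊗[ℂ] M) coaC

theorem core1 (coaC : C →ₗ[ℂ] C ⊗[ℂ] H) (actM : M ⊗[ℂ] H →ₗ[ℂ] M) (w : H) (m : M)
    (t : C ⊗[ℂ] H) :
    Ph coaC actM (LinearMap.lTensor C ((TensorProduct.mk ℂ H M).flip m ∘ₗ
      LinearMap.mulRight ℂ w) t) =
    LinearMap.lTensor C (GG actM w m)
      (TensorProduct.assoc ℂ C H H (LinearMap.rTensor H coaC t)) := by
  induction t with
  | zero => simp
  | add x y hx hy => simp only [map_add, hx, hy]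
  | tmul c k =>
    simp only [Ph, LinearMap.comp_apply, LinearMap.lTensor_tmul,
      LinearMap.rTensor_tmul, LinearEquiv.coe_coe]
    generalize coaC c = s
    induction s with
    | zero => simp
    | add x y hx hy => simp only [map_add, TensorProduct.add_tmul, hx, hy]
    | tmul p q => simp [GG]

theorem core (coaC : C →ₗ[ℂ] C ⊗[ℂ] H) (actM : M ⊗[ℂ] H →ₗ[ℂ] M)
    (hC : IsComoduleCoalgebra C H coaC) (w : H) (m : M) (c : C) :
    Ph coaC actM (LinearMap.lTensor C ((TensorProduct.mk ℂ H M).flip m ∘ₗ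
      LinearMap.mulRight ℂ w) (coaC c)) =
    LinearMap.lTensor C (KK actM w m)
      (TensorProduct.assoc ℂ C H H (LinearMap.rTensor H coaC (coaC c))) := by
  have h := LinearMap.congr_fun hC.coassoc c
  simp only [LinearMap.comp_apply, LinearEquiv.coe_coe] at h
  rw [core1, ← h, ← LinearMap.comp_apply, ← LinearMap.lTensor_comp, GG_comul,
    LinearMap.lTensor_comp, LinearMap.comp_apply]

/-- tau at level zero -/
def tauZ (coaC : C →ₗ[ℂ] C ⊗[ℂ] H) (actM : M ⊗[ℂ] H →ₗ[ℂ] M) : C ⊗[ℂ] M →ₗ[ℂ] C ⊗[ℂ] M :=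
  LinearMap.lTensor C (actM ∘ₗ (TensorProduct.comm ℂ H M).toLinearMap)
          ∘ₗ (TensorProduct.assoc ℂ C H M).toLinearMap
          ∘ₗ LinearMap.rTensor M coaC

theorem tauZ_coaM (coaC : C →ₗ[ℂ] C ⊗[ℂ] H) (actM : M ⊗[ℂ] H →ₗ[ℂ] M)
    (coaM : M →ₗ[ℂ] H ⊗[ℂ] M) (hM : IsSAYD H M actM coaM) (x : C ⊗[ℂ] M) :
    LinearMap.lTensor C coaM (tauZ coaC actM x) =
      Ph coaC actM (LinearMap.lTensor C coaM x) := by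
  induction x with
  | zero => simp
  | add x y hx hy => simp only [map_add, hx, hy]
  | tmul c m =>
    simp only [tauZ, Ph, LinearMap.comp_apply, LinearMap.lTensor_tmul,
      LinearMap.rTensor_tmul, LinearEquiv.coe_coe]
    generalize coaC c = s
    induction s with
    | zero => simp
    | add x y hx hy => simp only [map_add, TensorProduct.add_tmul, hx, hy]
    | tmul p q =>
      have h := LinearMap.congr_fun hM.ayd (m ⊗ₜ[ℂ] q)
      simp only [LinearMap.comp_apply, LinearMap.rTensor_tmul] at h
      simp [h]

theorem tauZ_K (coaC : C →ₗ[ℂ] C ⊗[ℂ] H) (actM : M ⊗[ℂ] H →ₗ[ℂ] M) (w : H) (m : M) (c : C) :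
    LinearMap.lTensor C (KK actM w m)
      (TensorProduct.assoc ℂ C H H (LinearMap.rTensor H coaC (coaC c))) =
    LinearMap.lTensor C (LinearMap.rTensor M (LinearMap.mulLeft ℂ w))
      (TensorProduct.assoc ℂ C H M (LinearMap.rTensor M coaC (tauZ coaC actM (c ⊗ₜ m)))) := by
  simp only [tauZ, LinearMap.comp_apply, LinearMap.rTensor_tmul, LinearEquiv.coe_coe]
  generalize coaC c = s
  induction s with
  | zero => simp
  | add x y hx hy => simp only [map_add, TensorProduct.add_tmul, hx, hy]
  | tmul p q =>
    simp only [LinearMap.comp_apply, LinearMap.lTensor_tmul,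
      LinearMap.rTensor_tmul, LinearEquiv.coe_coe, TensorProduct.assoc_tmul,
      TensorProduct.comm_tmul]
    generalize coaC p = s
    induction s with
    | zero => simp
    | add x y hx hy => simp only [map_add, TensorProduct.add_tmul, hx, hy]
    | tmul p q => simp [KK]

theorem zero_case (coaC : C →ₗ[ℂ] C ⊗[ℂ] H) (actM : M ⊗[ℂ] H →ₗ[ℂ] M)
    (coaM : M →ₗ[ℂ] H ⊗[ℂ] M) (hC : IsComoduleCoalgebra C H coaC)
    (hM : IsSAYD H M actM coaM) (x : C ⊗[ℂ] M)
    (hx : TensorProduct.assoc ℂ C H M (LinearMap.rTensor M coaC x)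
      = LinearMap.lTensor C coaM x) :
    TensorProduct.assoc ℂ C H M (LinearMap.rTensor M coaC (tauZ coaC actM x))
      = LinearMap.lTensor C coaM (tauZ coaC actM x) := by
  rw [tauZ_coaM coaC actM coaM hM, ← hx]
  clear hx
  induction x with
  | zero => simp
  | add x y hx hy => simp only [map_add, hx, hy]
  | tmul c m =>
    have h := core coaC actM hC 1 m c
    rw [tauZ_K] at h
    simp only [LinearMap.mulLeft_one, LinearMap.mulRight_one, LinearMap.rTensor_id,
      LinearMap.lTensor_id, LinearMap.id_apply, LinearMap.comp_id] at h
    rw [← h]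
    congr 1
    rw [LinearMap.rTensor_tmul]
    generalize coaC c = s
    induction s with
    | zero => simp
    | add x y hx hy => simp only [map_add, TensorProduct.add_tmul, hx, hy]
    | tmul p q => simp

section V
variable {V : Type} [AddCommGroup V] [Module ℂ V]

/-- diagonal coaction -/
def diag {A B : Type} [AddCommGroup A] [Module ℂ A] [AddCommGroup B] [Module ℂ B]
    (f : A →ₗ[ℂ] A ⊗[ℂ] H) (g : B →ₗ[ℂ] B ⊗[ℂ] H) : A ⊗[ℂ] B →ₗ[ℂ] (A ⊗[ℂ] B) ⊗[ℂ] H :=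
  LinearMap.lTensor (A ⊗[ℂ] B) (LinearMap.mul' ℂ H)
          ∘ₗ (TensorProduct.tensorTensorTensorComm ℂ A H B H).toLinearMap
          ∘ₗ TensorProduct.map f g

variable (V) in
/-- move the V out -/
def mv (N : Type) [AddCommGroup N] [Module ℂ N] :
    (C ⊗[ℂ] V) ⊗[ℂ] N ≃ₗ[ℂ] V ⊗[ℂ] (C ⊗[ℂ] N) :=
  (TensorProduct.congr (TensorProduct.comm ℂ C V) (LinearEquiv.refl ℂ N)).trans
    (TensorProduct.assoc ℂ V C N)

variable (V) in
def tauV (coaC : C →ₗ[ℂ] C ⊗[ℂ] H) (actM : M ⊗[ℂ] H →ₗ[ℂ] M) :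
    (C ⊗[ℂ] V) ⊗[ℂ] M →ₗ[ℂ] (V ⊗[ℂ] C) ⊗[ℂ] M :=
  (TensorProduct.assoc ℂ V C M).symm.toLinearMap ∘ₗ LinearMap.lTensor V (tauZ coaC actM)
    ∘ₗ (mv V M).toLinearMap

variable (V) in
def PhV (coaC : C →ₗ[ℂ] C ⊗[ℂ] H) (actM : M ⊗[ℂ] H →ₗ[ℂ] M) :
    (C ⊗[ℂ] V) ⊗[ℂ] (H ⊗[ℂ] M) →ₗ[ℂ] (V ⊗[ℂ] C) ⊗[ℂ] (H ⊗[ℂ] M) :=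
  (TensorProduct.assoc ℂ V C (H ⊗[ℂ] M)).symm.toLinearMap
    ∘ₗ LinearMap.lTensor V (Ph coaC actM)
    ∘ₗ (mv V (H ⊗[ℂ] M)).toLinearMap

theorem assoc_symm_lTensor {A B N P : Type} [AddCommGroup A] [Module ℂ A]
    [AddCommGroup B] [Module ℂ B] [AddCommGroup N] [Module ℂ N] [AddCommGroup P] [Module ℂ P]
    (f : N →ₗ[ℂ] P) (v : A) (t : B ⊗[ℂ] N) :
    LinearMap.lTensor (A ⊗[ℂ] B) f ((TensorProduct.assoc ℂ A B N).symm (v ⊗ₜ t)) =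
    (TensorProduct.assoc ℂ A B P).symm (v ⊗ₜ (LinearMap.lTensor B f t)) := by
  induction t with
  | zero => simp
  | add x y hx hy => simp only [map_add, TensorProduct.tmul_add, hx, hy]
  | tmul p q => simp

theorem tauV_coaM (coaC : C →ₗ[ℂ] C ⊗[ℂ] H) (actM : M ⊗[ℂ] H →ₗ[ℂ] M)
    (coaM : M →ₗ[ℂ] H ⊗[ℂ] M) (hM : IsSAYD H M actM coaM) (x : (C ⊗[ℂ] V) ⊗[ℂ] M) :
    LinearMap.lTensor (V ⊗[ℂ] C) coaM (tauV V coaC actM x) =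
      PhV V coaC actM (LinearMap.lTensor (C ⊗[ℂ] V) coaM x) := by
  have e : LinearMap.lTensor (V ⊗[ℂ] C) coaM ∘ₗ (tauV V coaC actM) =
      PhV V coaC actM ∘ₗ (LinearMap.lTensor (C ⊗[ℂ] V) coaM) := by
    apply TensorProduct.ext_threefold
    intro c v m
    have h := tauZ_coaM coaC actM coaM hM (c ⊗ₜ m)
    rw [LinearMap.lTensor_tmul] at h
    simp only [tauV, PhV, mv, LinearMap.comp_apply, LinearEquiv.coe_coe, LinearEquiv.trans_apply,
      TensorProduct.congr_tmul, TensorProduct.comm_tmul, LinearEquiv.refl_apply,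
      TensorProduct.assoc_tmul, LinearMap.lTensor_tmul, assoc_symm_lTensor, h]
  exact LinearMap.congr_fun e x

set_option maxHeartbeats 2000000 in
theorem V_left (coaC : C →ₗ[ℂ] C ⊗[ℂ] H) (actM : M ⊗[ℂ] H →ₗ[ℂ] M)
    (hC : IsComoduleCoalgebra C H coaC) (ρ : V →ₗ[ℂ] V ⊗[ℂ] H)
    (x : (C ⊗[ℂ] V) ⊗[ℂ] M) :
    TensorProduct.assoc ℂ (V ⊗[ℂ] C) H M (LinearMap.rTensor M (diag ρ coaC) (tauV V coaC actM x))
      = PhV V coaC actM (TensorProduct.assoc ℂ (C ⊗[ℂ] V) H M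
          (LinearMap.rTensor M (diag coaC ρ) x)) := by
  have e : (TensorProduct.assoc ℂ (V ⊗[ℂ] C) H M).toLinearMap ∘ₗ
        LinearMap.rTensor M (diag ρ coaC) ∘ₗ tauV V coaC actM
      = PhV V coaC actM ∘ₗ (TensorProduct.assoc ℂ (C ⊗[ℂ] V) H M).toLinearMap ∘ₗ
          LinearMap.rTensor M (diag coaC ρ) := by
    apply TensorProduct.ext_threefold
    intro c v m
    simp only [tauV, mv, LinearMap.comp_apply, LinearEquiv.coe_coe, LinearEquiv.trans_apply,
      TensorProduct.congr_tmul, TensorProduct.comm_tmul, LinearEquiv.refl_apply,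
      TensorProduct.assoc_tmul, LinearMap.lTensor_tmul, LinearMap.rTensor_tmul]
    have h1 : ∀ y : C ⊗[ℂ] M, TensorProduct.assoc ℂ (V ⊗[ℂ] C) H M
        (LinearMap.rTensor M (diag ρ coaC) ((TensorProduct.assoc ℂ V C M).symm (v ⊗ₜ y))) =
        TensorProduct.lift (LinearMap.mk₂ ℂ (fun (a : V) (w : H) =>
          (TensorProduct.assoc ℂ V C (H ⊗[ℂ] M)).symm (a ⊗ₜ
            LinearMap.lTensor C (LinearMap.rTensor M (LinearMap.mulLeft ℂ w))
            (TensorProduct.assoc ℂ C H M (LinearMap.rTensor M coaC y))))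
          (by intros; simp [TensorProduct.add_tmul])
          (by intros; rw [← TensorProduct.smul_tmul', map_smul])
          (by
            intro a w w'
            have : LinearMap.mulLeft ℂ (w + w') = LinearMap.mulLeft ℂ w + LinearMap.mulLeft ℂ w' := by
              ext; simp [add_mul]
            simp [this, LinearMap.rTensor_add, LinearMap.lTensor_add, TensorProduct.tmul_add])
          (by
            intro r a w
            have : LinearMap.mulLeft ℂ (r • w) = r • LinearMap.mulLeft ℂ w := by
              apply LinearMap.ext; intro z; simp
            simp [this, LinearMap.rTensor_smul, LinearMap.lTensor_smul])) (ρ v) := by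
      intro y
      induction y with
      | zero =>
        simp only [TensorProduct.tmul_zero, map_zero]
        generalize ρ v = s
        induction s with
        | zero => simp
        | add x y hx hy => rw [map_add, ← hx, ← hy, add_zero]
        | tmul p q => simp
      | add x y hx hy =>
        simp only [map_add, TensorProduct.tmul_add, hx, hy]
        generalize ρ v = s
        induction s with
        | zero => simp
        | add x y hx hy => simp only [map_add, ← hx, ← hy]; abel
        | tmul p q => simp [TensorProduct.tmul_add]
      | tmul d n =>
        simp only [TensorProduct.assoc_symm_tmul, LinearMap.rTensor_tmul, diag,
          LinearMap.comp_apply, TensorProduct.map_tmul]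
        generalize ρ v = s
        induction s with
        | zero => simp
        | add x y hx hy => simp only [map_add, TensorProduct.add_tmul, hx, hy]
        | tmul p q =>
          simp only [TensorProduct.lift.tmul, LinearMap.mk₂_apply]
          generalize coaC d = u
          induction u with
          | zero => simp
          | add x y hx hy => simp only [map_add, TensorProduct.add_tmul, TensorProduct.tmul_add, hx, hy]
          | tmul a b => simp
    rw [h1]
    simp only [diag, LinearMap.comp_apply, TensorProduct.map_tmul, LinearEquiv.coe_coe]
    generalize ρ v = s
    induction s with
    | zero => simp
    | add x y hx hy => simp only [map_add, TensorProduct.add_tmul, TensorProduct.tmul_add, hx, hy]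
    | tmul a w =>
      simp only [TensorProduct.lift.tmul, LinearMap.mk₂_apply]
      rw [← tauZ_K, ← core coaC actM hC]
      generalize coaC c = u
      induction u with
      | zero => simp
      | add x y hx hy => simp only [map_add, TensorProduct.add_tmul, TensorProduct.tmul_add, hx, hy]
      | tmul p q => simp [PhV, mv]
  exact LinearMap.congr_fun e x

end V

theorem snoc_coa (coaC : C →ₗ[ℂ] C ⊗[ℂ] H) : ∀ n : ℕ,
    coaT coaC (n + 1) ∘ₗ snoc C n =
      LinearMap.rTensor H (snoc C n) ∘ₗ diag (coaT coaC n) coaC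
  | 0 => by
    change diag coaC coaC ∘ₗ LinearMap.id = LinearMap.rTensor H LinearMap.id ∘ₗ diag coaC coaC
    rw [LinearMap.rTensor_id]; rfl
  | (n + 1) => by
    have ih := snoc_coa coaC n
    change diag coaC (coaT coaC (n + 1)) ∘ₗ (LinearMap.lTensor C (snoc C n)
          ∘ₗ (TensorProduct.assoc ℂ C (↥(Tpow C n)) C).toLinearMap) =
      LinearMap.rTensor H (LinearMap.lTensor C (snoc C n)
          ∘ₗ (TensorProduct.assoc ℂ C (↥(Tpow C n)) C).toLinearMap) ∘ₗ
        diag (diag coaC (coaT coaC n)) coaC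
    generalize coaT coaC (n + 1) = f at *
    generalize coaT coaC n = g at *
    generalize snoc C n = s at *
    apply TensorProduct.ext_threefold
    intro c v d
    have ih' := LinearMap.congr_fun ih (v ⊗ₜ d)
    simp only [diag, LinearMap.comp_apply, TensorProduct.map_tmul, LinearEquiv.coe_coe,
      TensorProduct.assoc_tmul, LinearMap.lTensor_tmul] at ih' ⊢
    rw [ih']
    generalize g v = y
    generalize coaC d = z
    generalize coaC c = x
    induction x with
    | zero => simp
    | add x x' hx hy => simp only [map_add, TensorProduct.add_tmul, hx, hy]
    | tmul p q =>
      induction y with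
      | zero => simp
      | add x x' hx hy => simp only [map_add, TensorProduct.add_tmul, TensorProduct.tmul_add, hx, hy]
      | tmul p' q' =>
        induction z with
        | zero => simp
        | add x x' hx hy => simp only [map_add, TensorProduct.tmul_add, hx, hy]
        | tmul p'' q'' => simp [mul_assoc]

theorem tau_succ (coaC : C →ₗ[ℂ] C ⊗[ℂ] H) (actM : M ⊗[ℂ] H →ₗ[ℂ] M) (n : ℕ)
    (x : (C ⊗[ℂ] ↥(Tpow C n)) ⊗[ℂ] M) :
    tau M coaC actM (n + 1) x = LinearMap.rTensor M (snoc C n) (tauV (Tpow C n) coaC actM x) := by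
  have e : (TensorProduct.map (snoc C n) actM
          ∘ₗ TensorProduct.map (TensorProduct.comm ℂ C (↥(Tpow C n))).toLinearMap
              (TensorProduct.comm ℂ H M).toLinearMap
          ∘ₗ (TensorProduct.tensorTensorTensorComm ℂ C H (↥(Tpow C n)) M).toLinearMap
          ∘ₗ (TensorProduct.assoc ℂ (C ⊗[ℂ] H) (↥(Tpow C n)) M).toLinearMap
          ∘ₗ LinearMap.rTensor M (LinearMap.rTensor (↥(Tpow C n)) coaC)) =
        LinearMap.rTensor M (snoc C n) ∘ₗ (tauV (Tpow C n) coaC actM) := by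
    apply TensorProduct.ext_threefold
    intro c v m
    simp only [tauV, tauZ, mv, LinearMap.comp_apply, LinearEquiv.coe_coe, LinearEquiv.trans_apply,
      TensorProduct.congr_tmul, TensorProduct.comm_tmul, LinearEquiv.refl_apply,
      TensorProduct.assoc_tmul, LinearMap.lTensor_tmul, LinearMap.rTensor_tmul]
    generalize coaC c = u
    induction u with
    | zero => simp
    | add x y hx hy => simp only [map_add, TensorProduct.add_tmul, TensorProduct.tmul_add, hx, hy]
    | tmul p q => simp
  exact LinearMap.congr_fun e x

theorem succ_case (coaC : C →ₗ[ℂ] C ⊗[ℂ] H) (actM : M ⊗[ℂ] H →ₗ[ℂ] M)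
    (coaM : M →ₗ[ℂ] H ⊗[ℂ] M) (hC : IsComoduleCoalgebra C H coaC)
    (hM : IsSAYD H M actM coaM) (n : ℕ) (x : (C ⊗[ℂ] ↥(Tpow C n)) ⊗[ℂ] M)
    (hx : TensorProduct.assoc ℂ (C ⊗[ℂ] ↥(Tpow C n)) H M
        (LinearMap.rTensor M (diag coaC (coaT coaC n)) x)
      = LinearMap.lTensor (C ⊗[ℂ] ↥(Tpow C n)) coaM x) :
    TensorProduct.assoc ℂ (↥(Tpow C (n + 1))) H M
        (LinearMap.rTensor M (coaT coaC (n + 1))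
          (LinearMap.rTensor M (snoc C n) (tauV (Tpow C n) coaC actM x)))
      = LinearMap.lTensor (↥(Tpow C (n + 1))) coaM
          (LinearMap.rTensor M (snoc C n) (tauV (Tpow C n) coaC actM x)) := by
  have h2 := V_left coaC actM hC (coaT coaC n) x
  rw [hx, ← tauV_coaM coaC actM coaM hM] at h2
  rw [← LinearMap.comp_apply, ← LinearMap.rTensor_comp, snoc_coa, LinearMap.rTensor_comp,
    LinearMap.comp_apply]
  generalize tauV (Tpow C n) coaC actM x = y at *
  have h3 := congrArg (LinearMap.rTensor (H ⊗[ℂ] M) (snoc C n)) h2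
  rw [← LinearMap.comp_apply (LinearMap.rTensor _ _) (LinearMap.lTensor _ _),
    LinearMap.rTensor_comp_lTensor, ← LinearMap.lTensor_comp_rTensor,
    LinearMap.comp_apply] at h3
  rw [← h3]
  generalize LinearMap.rTensor M (diag (coaT coaC n) coaC) y = z
  have e : (TensorProduct.assoc ℂ (↥(Tpow C (n + 1))) H M).toLinearMap ∘ₗ
      LinearMap.rTensor M (LinearMap.rTensor H (snoc C n)) =
      LinearMap.rTensor (H ⊗[ℂ] M) (snoc C n) ∘ₗ
        (TensorProduct.assoc ℂ (↥(Tpow C n) ⊗[ℂ] C) H M).toLinearMap := by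
    apply TensorProduct.ext_threefold
    intro a b c
    simp
  exact LinearMap.congr_fun e z

end Helpers

theorem tau_maps_cotensor_to_itself
    (coaC : C →ₗ[ℂ] C ⊗[ℂ] H) (actM : M ⊗[ℂ] H →ₗ[ℂ] M)
    (coaM : M →ₗ[ℂ] H ⊗[ℂ] M)
    (hC : IsComoduleCoalgebra C H coaC) (hM : IsSAYD H M actM coaM) :
    ∀ n : ℕ, ∀ x ∈ CotM M coaC coaM n, tau M coaC actM n x ∈ CotM M coaC coaM n := by
  intro n x hx
  cases n with
  | zero => exact zero_case coaC actM coaM hC hM x hx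
  | succ n =>
    have h := succ_case coaC actM coaM hC hM n x hx
    have e := tau_succ coaC actM n x
    have key : ∀ y : ↥(Tpow C (n + 1)) ⊗[ℂ] M, tau M coaC actM (n + 1) x = y →
        y ∈ CotM M coaC coaM (n + 1) →
        tau M coaC actM (n + 1) x ∈ CotM M coaC coaM (n + 1) := by
      intro y h1 h2
      rw [h1]
      exact h2
    exact key _ e h

end Stmt17
end
end

section
/- Let H be a Hopf algebra over ℂ, C a right H-comodule coalgebra, and M a right-left stable anti-Yetter–Drinfeld module over H. For each n ≥ 0, the operator τ_n on the cotensor product C^{⊗(n+1)}□_H M defined by τ_n(c₀⊗c₁⊗…⊗c_n⊗m) = c₁⊗…⊗c_n⊗(c₀)₍₀₎ ⊗ m·(c₀)₍₁₎ satisfies τ_n^{n+1} = id. -/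
/-!
STATEMENT 18: Let `H` be a Hopf algebra over `ℂ`, `C` a right `H`-comodule
coalgebra, and `M` a right-left stable anti-Yetter–Drinfeld module over `H`.
For each `n ≥ 0`, the operator
`τ_n (c₀ ⊗ … ⊗ c_n ⊗ m) = c₁ ⊗ … ⊗ c_n ⊗ (c₀)₍₀₎ ⊗ m · (c₀)₍₁₎`
on the cotensor product `C^{⊗(n+1)} □_H M` satisfies `τ_n^{n+1} = id`.
-/

open TensorProduct

noncomputable section

namespace Stmt18

variable (C H M : Type) [Ring H] [HopfAlgebra ℂ H]
  [AddCommGroup C] [Module ℂ C] [Coalgebra ℂ C]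
  [AddCommGroup M] [Module ℂ M]

/-- `Θ (h) = h⁽¹⁾ ⊗ (h⁽²⁾ ⊗ S(h⁽³⁾))`. -/
def Θ : H →ₗ[ℂ] H ⊗[ℂ] (H ⊗[ℂ] H) :=
  LinearMap.lTensor H (LinearMap.lTensor H (HopfAlgebra.antipode (R := ℂ)))
    ∘ₗ (TensorProduct.assoc ℂ H H H).toLinearMap
    ∘ₗ LinearMap.rTensor H (Coalgebra.comul (R := ℂ))
    ∘ₗ Coalgebra.comul (R := ℂ)

/-- `(k ⊗ m) ⊗ h ↦ S(h⁽³⁾) k h⁽¹⁾ ⊗ m · h⁽²⁾` (the right-hand side of the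
anti-Yetter–Drinfeld condition). -/
def aydM (actM : M ⊗[ℂ] H →ₗ[ℂ] M) : (H ⊗[ℂ] M) ⊗[ℂ] H →ₗ[ℂ] H ⊗[ℂ] M :=
  LinearMap.rTensor M (LinearMap.mul' ℂ H)
    ∘ₗ (TensorProduct.assoc ℂ H H M).symm.toLinearMap
    ∘ₗ (TensorProduct.comm ℂ (H ⊗[ℂ] M) H).toLinearMap
    ∘ₗ (TensorProduct.assoc ℂ H M H).symm.toLinearMap
    ∘ₗ TensorProduct.map (LinearMap.mul' ℂ H)
        (LinearMap.rTensor H actM ∘ₗ (TensorProduct.assoc ℂ M H H).symm.toLinearMap)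
    ∘ₗ (TensorProduct.tensorTensorTensorComm ℂ H M H (H ⊗[ℂ] H)).toLinearMap
    ∘ₗ LinearMap.lTensor (H ⊗[ℂ] M) (Θ H)

/-- `C` is a right `H`-comodule coalgebra via the coaction `coaC`. -/
structure IsComoduleCoalgebra (coaC : C →ₗ[ℂ] C ⊗[ℂ] H) : Prop where
  coassoc : LinearMap.lTensor C (Coalgebra.comul (R := ℂ)) ∘ₗ coaC
    = (TensorProduct.assoc ℂ C H H).toLinearMap ∘ₗ LinearMap.rTensor H coaC ∘ₗ coaC
  counit : (TensorProduct.rid ℂ C).toLinearMap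
      ∘ₗ LinearMap.lTensor C (Coalgebra.counit (R := ℂ)) ∘ₗ coaC = LinearMap.id
  comul_compat : LinearMap.lTensor (C ⊗[ℂ] C) (LinearMap.mul' ℂ H)
      ∘ₗ (TensorProduct.tensorTensorTensorComm ℂ C H C H).toLinearMap
      ∘ₗ TensorProduct.map coaC coaC ∘ₗ Coalgebra.comul (R := ℂ)
    = LinearMap.rTensor H (Coalgebra.comul (R := ℂ)) ∘ₗ coaC
  counit_compat : (TensorProduct.lid ℂ H).toLinearMap
      ∘ₗ LinearMap.rTensor H (Coalgebra.counit (R := ℂ)) ∘ₗ coaC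
    = Algebra.linearMap ℂ H ∘ₗ Coalgebra.counit (R := ℂ)

/-- `M` is a right-left stable anti-Yetter–Drinfeld module over `H` via the
action `actM` and the coaction `coaM`. -/
structure IsSAYD (actM : M ⊗[ℂ] H →ₗ[ℂ] M) (coaM : M →ₗ[ℂ] H ⊗[ℂ] M) : Prop where
  act_one : ∀ m : M, actM (m ⊗ₜ[ℂ] 1) = m
  act_mul : ∀ (m : M) (h h' : H),
    actM (actM (m ⊗ₜ[ℂ] h) ⊗ₜ[ℂ] h') = actM (m ⊗ₜ[ℂ] (h * h'))
  coassoc : (TensorProduct.assoc ℂ H H M).toLinearMap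
      ∘ₗ LinearMap.rTensor M (Coalgebra.comul (R := ℂ)) ∘ₗ coaM
    = LinearMap.lTensor H coaM ∘ₗ coaM
  counit : (TensorProduct.lid ℂ M).toLinearMap
      ∘ₗ LinearMap.rTensor M (Coalgebra.counit (R := ℂ)) ∘ₗ coaM = LinearMap.id
  ayd : coaM ∘ₗ actM = aydM H M actM ∘ₗ LinearMap.rTensor H coaM
  stable : actM ∘ₗ (TensorProduct.comm ℂ H M).toLinearMap ∘ₗ coaM = LinearMap.id

/-- The iterated tensor power `Tpow n = C^{⊗(n+1)}`. -/
def Tpow : ℕ → ModuleCat ℂ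
  | 0 => ModuleCat.of ℂ C
  | (n + 1) => ModuleCat.of ℂ (C ⊗[ℂ] (Tpow n))

/-- Appending a factor at the right end: `Tpow n ⊗ C → Tpow (n+1)`. -/
def snoc : (n : ℕ) → (↥(Tpow C n) ⊗[ℂ] C →ₗ[ℂ] ↥(Tpow C (n + 1)))
  | 0 => LinearMap.id
  | (n + 1) =>
      (LinearMap.lTensor C (snoc n)
          ∘ₗ (TensorProduct.assoc ℂ C (↥(Tpow C n)) C).toLinearMap :
        (C ⊗[ℂ] ↥(Tpow C n)) ⊗[ℂ] C →ₗ[ℂ] C ⊗[ℂ] ↥(Tpow C (n + 1)))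

variable {C H}

/-- The diagonal right `H`-coaction on `Tpow n`:
`c₀ ⊗ … ⊗ c_n ↦ (c₀)₍₀₎ ⊗ … ⊗ (c_n)₍₀₎ ⊗ (c₀)₍₁₎ (c₁)₍₁₎ ⋯ (c_n)₍₁₎`. -/
def coaT (coaC : C →ₗ[ℂ] C ⊗[ℂ] H) :
    (n : ℕ) → (↥(Tpow C n) →ₗ[ℂ] ↥(Tpow C n) ⊗[ℂ] H)
  | 0 => coaC
  | (n + 1) =>
      (LinearMap.lTensor (C ⊗[ℂ] ↥(Tpow C n)) (LinearMap.mul' ℂ H)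
          ∘ₗ (TensorProduct.tensorTensorTensorComm ℂ C H (↥(Tpow C n)) H).toLinearMap
          ∘ₗ TensorProduct.map coaC (coaT coaC n) :
        C ⊗[ℂ] ↥(Tpow C n) →ₗ[ℂ] (C ⊗[ℂ] ↥(Tpow C n)) ⊗[ℂ] H)



/-- The cotensor product `C^{⊗(n+1)} □_H M` inside `Tpow n ⊗ M`. -/
def CotM (coaC : C →ₗ[ℂ] C ⊗[ℂ] H) (coaM : M →ₗ[ℂ] H ⊗[ℂ] M) (n : ℕ) :
    Submodule ℂ (↥(Tpow C n) ⊗[ℂ] M) :=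
  LinearMap.eqLocus
    ((TensorProduct.assoc ℂ (↥(Tpow C n)) H M).toLinearMap
      ∘ₗ LinearMap.rTensor M (coaT coaC n))
    (LinearMap.lTensor (↥(Tpow C n)) coaM)

/-- The cyclic operator
`τ_n (c₀ ⊗ … ⊗ c_n ⊗ m) = c₁ ⊗ … ⊗ c_n ⊗ (c₀)₍₀₎ ⊗ m · (c₀)₍₁₎`. -/
def tau (coaC : C →ₗ[ℂ] C ⊗[ℂ] H) (actM : M ⊗[ℂ] H →ₗ[ℂ] M) :
    (n : ℕ) → (↥(Tpow C n) ⊗[ℂ] M →ₗ[ℂ] ↥(Tpow C n) ⊗[ℂ] M)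
  | 0 =>
      (LinearMap.lTensor C (actM ∘ₗ (TensorProduct.comm ℂ H M).toLinearMap)
          ∘ₗ (TensorProduct.assoc ℂ C H M).toLinearMap
          ∘ₗ LinearMap.rTensor M coaC :
        C ⊗[ℂ] M →ₗ[ℂ] C ⊗[ℂ] M)
  | (n + 1) =>
      (TensorProduct.map (snoc C n) actM
          ∘ₗ TensorProduct.map (TensorProduct.comm ℂ C (↥(Tpow C n))).toLinearMap
              (TensorProduct.comm ℂ H M).toLinearMap
          ∘ₗ (TensorProduct.tensorTensorTensorComm ℂ C H (↥(Tpow C n)) M).toLinearMap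
          ∘ₗ (TensorProduct.assoc ℂ (C ⊗[ℂ] H) (↥(Tpow C n)) M).toLinearMap
          ∘ₗ LinearMap.rTensor M (LinearMap.rTensor (↥(Tpow C n)) coaC) :
        (C ⊗[ℂ] ↥(Tpow C n)) ⊗[ℂ] M →ₗ[ℂ] (C ⊗[ℂ] ↥(Tpow C n)) ⊗[ℂ] M)

/-- The pure tensor `f 0 ⊗ … ⊗ f n`. -/
def pureT : (n : ℕ) → (ℕ → C) → ↥(Tpow C n)
  | 0, f => (f 0 : C)
  | (n + 1), f => (f 0 ⊗ₜ[ℂ] pureT n (fun i => f (i + 1)) : C ⊗[ℂ] ↥(Tpow C n))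

theorem pureT_congr (n : ℕ) : ∀ (f g : ℕ → C), (∀ i ≤ n, f i = g i) →
    pureT n f = pureT n g := by
  induction n with
  | zero => intro f g h; exact h 0 le_rfl
  | succ n ih =>
    intro f g h
    show (f 0 ⊗ₜ[ℂ] pureT n (fun i => f (i + 1)) : C ⊗[ℂ] ↥(Tpow C n))
      = g 0 ⊗ₜ[ℂ] pureT n (fun i => g (i + 1))
    rw [h 0 (Nat.zero_le _), ih (fun i => f (i + 1)) (fun i => g (i + 1))
      (fun i hi => h (i + 1) (by omega))]

theorem ext_pureT {N : Type} [AddCommGroup N] [Module ℂ N] (n : ℕ) :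
    ∀ (F G : ↥(Tpow C n) →ₗ[ℂ] N), (∀ f, F (pureT n f) = G (pureT n f)) → F = G := by
  induction n with
  | zero =>
    intro F G h
    refine LinearMap.ext fun (x : C) => ?_
    exact h (fun _ => x)
  | succ n ih =>
    intro F G h
    refine TensorProduct.ext (R := ℂ) (M := C) (N := ↥(Tpow C n)) ?_
    refine LinearMap.ext fun c => ?_
    refine ih _ _ fun f => ?_
    exact h (fun i => Nat.casesOn i c f)

theorem snoc_pureT (n : ℕ) : ∀ (f : ℕ → C) (a : C),
    snoc C n (pureT n f ⊗ₜ[ℂ] a) = pureT (n + 1) (fun i => if i < n + 1 then f i else a) := by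
  induction n with
  | zero => intro f a; rfl
  | succ n ih =>
    intro f a
    show (f 0 ⊗ₜ[ℂ] snoc C n (pureT n (fun i => f (i + 1)) ⊗ₜ[ℂ] a) : C ⊗[ℂ] ↥(Tpow C (n+1)))
      = f 0 ⊗ₜ[ℂ] pureT (n + 1) _
    rw [ih]
    congr 1
    refine pureT_congr _ _ _ fun i _ => ?_
    simp

theorem tau_pureT (coaC : C →ₗ[ℂ] C ⊗[ℂ] H) (actM : M ⊗[ℂ] H →ₗ[ℂ] M) (n : ℕ)
    (f : ℕ → C) (m : M) (S : Finset (C × H)) (hS : coaC (f 0) = ∑ x ∈ S, x.1 ⊗ₜ[ℂ] x.2) :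
    tau M coaC actM n (pureT n f ⊗ₜ[ℂ] m) =
      ∑ x ∈ S, pureT n (fun i => if i < n then f (i + 1) else x.1) ⊗ₜ[ℂ]
        actM (m ⊗ₜ[ℂ] x.2) := by
  cases n with
  | zero =>
    show LinearMap.lTensor C (actM ∘ₗ (TensorProduct.comm ℂ H M).toLinearMap)
      (TensorProduct.assoc ℂ C H M (coaC (f 0) ⊗ₜ[ℂ] m)) = _
    rw [hS, TensorProduct.sum_tmul, map_sum, map_sum]
    rfl
  | succ n =>
    show TensorProduct.map (snoc C n) actM
      (TensorProduct.map (TensorProduct.comm ℂ C (↥(Tpow C n))).toLinearMap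
              (TensorProduct.comm ℂ H M).toLinearMap
        (TensorProduct.tensorTensorTensorComm ℂ C H (↥(Tpow C n)) M
          (TensorProduct.assoc ℂ (C ⊗[ℂ] H) (↥(Tpow C n)) M
            ((coaC (f 0) ⊗ₜ[ℂ] pureT n (fun i => f (i + 1))) ⊗ₜ[ℂ] m)))) = _
    rw [hS, TensorProduct.sum_tmul, TensorProduct.sum_tmul, map_sum, map_sum, map_sum, map_sum]
    refine Finset.sum_congr rfl fun x _ => ?_
    show snoc C n (pureT n (fun i => f (i + 1)) ⊗ₜ[ℂ] x.1) ⊗ₜ[ℂ] actM (m ⊗ₜ[ℂ] x.2) = _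
    rw [snoc_pureT]

/-- `h ↦ m · h`. -/
def actL (actM : M ⊗[ℂ] H →ₗ[ℂ] M) (m : M) : H →ₗ[ℂ] M :=
  actM ∘ₗ TensorProduct.mk ℂ M H m

theorem tau_iter (coaC : C →ₗ[ℂ] C ⊗[ℂ] H) (actM : M ⊗[ℂ] H →ₗ[ℂ] M)
    (hact : ∀ (m : M) (h h' : H),
      actM (actM (m ⊗ₜ[ℂ] h) ⊗ₜ[ℂ] h') = actM (m ⊗ₜ[ℂ] (h * h'))) (n : ℕ) (k : ℕ) :
    k ≤ n → ∀ (f : ℕ → C) (m : M) (Ψ : ↥(Tpow C k) →ₗ[ℂ] ↥(Tpow C n)),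
      (∀ g, Ψ (pureT k g) =
        pureT n (fun i => if i < n - k then f (i + k + 1) else g (i - (n - k)))) →
      (⇑(tau M coaC actM n))^[k + 1] (pureT n f ⊗ₜ[ℂ] m) =
        TensorProduct.map Ψ (actL M actM m) (coaT coaC k (pureT k f)) := by
  induction k with
  | zero =>
    intro _ f m Ψ hΨ
    obtain ⟨S, hS⟩ := TensorProduct.exists_finset (coaC (f 0))
    rw [Function.iterate_one, tau_pureT M coaC actM n f m S hS]
    show _ = TensorProduct.map Ψ (actL M actM m) (coaC (f 0))
    rw [hS]
    refine Eq.trans ?_ (map_sum (TensorProduct.map Ψ (actL M actM m)) _ S).symm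
    refine Finset.sum_congr rfl fun x _ => ?_
    show _ = Ψ (pureT 0 (fun _ => x.1)) ⊗ₜ[ℂ] actM (m ⊗ₜ[ℂ] x.2)
    rw [hΨ]
    rfl
  | succ k ih =>
    intro hk f m Ψ hΨ
    obtain ⟨S, hS⟩ := TensorProduct.exists_finset (coaC (f 0))
    have hit : ∀ y, (⇑(tau M coaC actM n))^[k + 1] y = ((tau M coaC actM n) ^ (k + 1)) y :=
      fun y => (Module.End.pow_apply _ _ _).symm
    rw [Function.iterate_succ_apply, tau_pureT M coaC actM n f m S hS, hit, map_sum]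
    show _ = TensorProduct.map Ψ (actL M actM m)
      (LinearMap.lTensor (C ⊗[ℂ] ↥(Tpow C k)) (LinearMap.mul' ℂ H)
        (TensorProduct.tensorTensorTensorComm ℂ C H (↥(Tpow C k)) H
          (coaC (f 0) ⊗ₜ[ℂ] coaT coaC k (pureT k (fun i => f (i + 1))))))
    rw [hS, TensorProduct.sum_tmul, map_sum, map_sum]
    refine Eq.trans ?_ (map_sum (TensorProduct.map Ψ (actL M actM m)) _ S).symm
    refine Finset.sum_congr rfl fun x _ => ?_
    let Ψ' : ↥(Tpow C k) →ₗ[ℂ] ↥(Tpow C n) := 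
      LinearMap.comp (M₂ := C ⊗[ℂ] ↥(Tpow C k)) Ψ (TensorProduct.mk ℂ C ↥(Tpow C k) x.1)
    rw [← hit, ih (by omega) _ _ Ψ' ?_]
    · rw [pureT_congr k (fun i => if i < n then f (i + 1) else x.1) (fun i => f (i + 1))
        (fun i hi => if_pos (by omega))]
      generalize coaT coaC k (pureT k (fun i => f (i + 1))) = Y
      induction Y using TensorProduct.induction_on with
      | zero =>
        rw [map_zero, TensorProduct.tmul_zero, map_zero, map_zero]
        exact (map_zero (TensorProduct.map Ψ (actL M actM m))).symm
      | add y z hy hz =>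
        rw [map_add, hy, hz, TensorProduct.tmul_add, map_add, map_add]
        exact (map_add (TensorProduct.map Ψ (actL M actM m)) _ _).symm
      | tmul t h =>
        show Ψ' t ⊗ₜ[ℂ] actM (actM (m ⊗ₜ[ℂ] x.2) ⊗ₜ[ℂ] h)
          = Ψ' t ⊗ₜ[ℂ] actM (m ⊗ₜ[ℂ] (x.2 * h))
        rw [hact]
    · intro g
      show Ψ (pureT (k + 1) (fun i => Nat.casesOn i x.1 g)) = _
      rw [hΨ]
      refine pureT_congr _ _ _ fun i hi => ?_
      by_cases h1 : i < n - (k + 1)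
      · have h2 : i < n - k := by omega
        have h3 : i + k + 1 < n := by omega
        simp only [h1, h2, h3, if_true]
        congr 1
      · by_cases h2 : i < n - k
        · have h3 : ¬ (i + k + 1 < n) := by omega
          have h4 : i - (n - (k + 1)) = 0 := by omega
          simp [h1, h2, h3, h4]
        · have h4 : i - (n - (k + 1)) = (i - (n - k)) + 1 := by omega
          simp only [h1, h2, h4, if_false]

theorem tau_pow_succ_eq_id
    (coaC : C →ₗ[ℂ] C ⊗[ℂ] H) (actM : M ⊗[ℂ] H →ₗ[ℂ] M)
    (coaM : M →ₗ[ℂ] H ⊗[ℂ] M)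
    (hC : IsComoduleCoalgebra C H coaC) (hM : IsSAYD H M actM coaM) :
    ∀ n : ℕ, ∀ x ∈ CotM M coaC coaM n, (⇑(tau M coaC actM n))^[n + 1] x = x := by
  intro n x hx
  have key : (tau M coaC actM n) ^ (n + 1) =
      LinearMap.lTensor (↥(Tpow C n)) (actM ∘ₗ (TensorProduct.comm ℂ H M).toLinearMap)
        ∘ₗ (TensorProduct.assoc ℂ (↥(Tpow C n)) H M).toLinearMap
        ∘ₗ LinearMap.rTensor M (coaT coaC n) := by
    refine TensorProduct.ext (ext_pureT n _ _ fun f => LinearMap.ext fun m => ?_)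
    show ((tau M coaC actM n) ^ (n + 1)) (pureT n f ⊗ₜ[ℂ] m) =
      LinearMap.lTensor (↥(Tpow C n)) (actM ∘ₗ (TensorProduct.comm ℂ H M).toLinearMap)
        (TensorProduct.assoc ℂ (↥(Tpow C n)) H M (coaT coaC n (pureT n f) ⊗ₜ[ℂ] m))
    rw [Module.End.pow_apply, tau_iter M coaC actM hM.act_mul n n le_rfl f m LinearMap.id
      (fun g => by simp)]
    generalize coaT coaC n (pureT n f) = Y
    induction Y using TensorProduct.induction_on with
    | zero => simp
    | add y z hy hz => rw [map_add, hy, hz, TensorProduct.add_tmul, map_add, map_add]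
    | tmul t h => rfl
  have hx' : (TensorProduct.assoc ℂ (↥(Tpow C n)) H M)
      (LinearMap.rTensor M (coaT coaC n) x) = LinearMap.lTensor (↥(Tpow C n)) coaM x := hx
  rw [← Module.End.pow_apply, key]
  show LinearMap.lTensor (↥(Tpow C n)) (actM ∘ₗ (TensorProduct.comm ℂ H M).toLinearMap)
    (TensorProduct.assoc ℂ (↥(Tpow C n)) H M (LinearMap.rTensor M (coaT coaC n) x)) = x
  rw [hx', ← LinearMap.comp_apply, ← LinearMap.lTensor_comp, LinearMap.comp_assoc, hM.stable,
    LinearMap.lTensor_id, LinearMap.id_apply]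

end Stmt18
end
end
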